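/- arXiv:0912.2538 — 5 statements merged into one kernel-verified Lean document; each statement's English description precedes it below -/
import Mathlib

section
/- Let (S1,Σ1,μ1) and (S2,Σ2,μ2) be σ-finite measure spaces and let T be the linear integral operator T f(s1) = ∫_{S2} K(s1,s2) f(s2) dμ2(s2) with a bimeasurable kernel K. For 1 ≤ q, p < ∞ let N(q,p) ∈ [0,∞] denote the operator norm of T from L^q(μ2) into L^p(μ1) (set N(q,p)=+∞ when T is unbounded between these spaces). Let ψ ∈ Ψ(a,b) and define ν(p) = inf_{q∈(a,b)} N(q,p)·ψ(q), and let (c,d) = { p : ν(p) < ∞ }. Then for every measurable f on S2, sup_{p∈(c,d)} |T f|_{p,μ1}/ν(p) ≤ sup_{q∈(a,b)} |f|_{q,μ2}/ψ(q); that is, ||T f||G(ν) ≤ ||f||G(ψ), so T is bounded from G(ψ) into G(ν) with norm at most 1. -/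
open MeasureTheory Real Set Filter ENNReal

theorem le_sInf_mul_of_forall_le_mul {s : Set ℝ≥0∞} {x y : ℝ≥0∞} (hs : sInf s ≠ ⊤) (hy : y ≠ ⊤)
    (h : ∀ C ∈ s, x ≤ C * y) : x ≤ sInf s * y := by
  rcases eq_or_ne y 0 with rfl | hy0
  · obtain ⟨C, hC⟩ : s.Nonempty := by
      by_contra hne
      simp [Set.not_nonempty_iff_eq_empty.1 hne] at hs
    simpa using h C hC
  · rw [← ENNReal.div_le_iff hy0 hy]
    exact le_sInf fun C hC => (ENNReal.div_le_iff hy0 hy).2 (h C hC)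

/-- boundedness of an integral operator between Bilateral Grand
Lebesgue Spaces: `‖T f‖G(ν) ≤ ‖f‖G(ψ)`. -/
theorem bgls_integral_operator_bound
    {S1 S2 : Type*} [MeasurableSpace S1] [MeasurableSpace S2]
    (μ1 : Measure S1) (μ2 : Measure S2) [SigmaFinite μ1] [SigmaFinite μ2]
    (K : S1 → S2 → ℝ) (hK : Measurable (Function.uncurry K))
    (T : (S2 → ℝ) → S1 → ℝ)
    (hT : ∀ f s1, T f s1 = ∫ s2, K s1 s2 * f s2 ∂μ2)
    -- `N q p` is the operator norm of `T` from `L^q(μ2)` to `L^p(μ1)`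
    -- (equal to `+∞` when `T` is unbounded between these spaces)
    (N : ℝ → ℝ → ℝ≥0∞)
    (hN : ∀ q p, N q p = sInf {C : ℝ≥0∞ | ∀ f : S2 → ℝ,
        eLpNorm (T f) (ENNReal.ofReal p) μ1 ≤ C * eLpNorm f (ENNReal.ofReal q) μ2})
    -- the exponent interval `(a,b)`, `1 ≤ a < b ≤ ∞`
    (a : ℝ) (b : ℝ≥0∞) (ha : 1 ≤ a) (hab : ENNReal.ofReal a < b)
    (I : Set ℝ) (hI : I = {p : ℝ | a < p ∧ ENNReal.ofReal p < b})
    -- `ψ ∈ Ψ(a,b)`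
    (ψ : ℝ → ℝ) (hψcont : ContinuousOn ψ I) (hψpos : ∀ p ∈ I, 0 < ψ p)
    (hψinf : ∃ ε > 0, ∀ p ∈ I, ε ≤ ψ p)
    -- `ν(p) = inf_{q ∈ (a,b)} N(q,p) ψ(q)`
    (ν : ℝ → ℝ≥0∞) (hν : ∀ p, ν p = ⨅ q ∈ I, N q p * ENNReal.ofReal (ψ q))
    -- the set where `ν` is finite
    (D : Set ℝ) (hD : D = {p : ℝ | 1 ≤ p ∧ ν p < ⊤})
    (f : S2 → ℝ) :
    (⨆ p ∈ D, eLpNorm (T f) (ENNReal.ofReal p) μ1 / ν p) ≤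
      ⨆ q ∈ I, eLpNorm f (ENNReal.ofReal q) μ2 / ENNReal.ofReal (ψ q) := by
  set M := ⨆ q ∈ I, eLpNorm f (ENNReal.ofReal q) μ2 / ENNReal.ofReal (ψ q)
  rcases eq_or_ne M ⊤ with hMtop | hMtop
  · simp [hMtop]
  have hf : ∀ q ∈ I, eLpNorm f (ENNReal.ofReal q) μ2 ≤ M * ENNReal.ofReal (ψ q) := fun q hq =>
    (ENNReal.div_le_iff (by simpa using hψpos q hq) ofReal_ne_top).1 <|
      le_iSup₂ (f := fun q (_ : q ∈ I) =>
        eLpNorm f (ENNReal.ofReal q) μ2 / ENNReal.ofReal (ψ q)) q hq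
  have hTf : ∀ p, ∀ q ∈ I, N q p ≠ ⊤ →
      eLpNorm (T f) (ENNReal.ofReal p) μ1 ≤ M * (N q p * ENNReal.ofReal (ψ q)) := by
    intro p q hq hNtop
    have hfin := ne_top_of_le_ne_top (ENNReal.mul_ne_top hMtop ofReal_ne_top) (hf q hq)
    have hle : eLpNorm (T f) (ENNReal.ofReal p) μ1 ≤
        N q p * eLpNorm f (ENNReal.ofReal q) μ2 := by
      rw [hN] at hNtop ⊢
      exact le_sInf_mul_of_forall_le_mul hNtop hfin fun C hC => hC f
    calc eLpNorm (T f) (ENNReal.ofReal p) μ1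
        ≤ N q p * (M * ENNReal.ofReal (ψ q)) := hle.trans (by gcongr; exact hf q hq)
      _ = M * (N q p * ENNReal.ofReal (ψ q)) := by ring
  refine iSup₂_le fun p hp => ENNReal.div_le_of_le_mul ?_
  rw [hD] at hp
  rcases eq_or_ne M 0 with hM0 | hM0
  · have hνp := hp.2
    simp only [hν, iInf_lt_iff] at hνp
    obtain ⟨q, hq, hlt⟩ := hνp
    have hNtop : N q p ≠ ⊤ := by
      intro h
      rw [h, ENNReal.top_mul (by simpa using hψpos q hq)] at hlt
      exact lt_irrefl _ hlt
    simpa [hM0] using hTf p q hq hNtop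
  · rw [mul_comm, ← ENNReal.div_le_iff hM0 hMtop, hν]
    refine le_iInf₂ fun q hq => ?_
    rcases eq_or_ne (N q p) ⊤ with hNtop | hNtop
    · simp [hNtop, ENNReal.top_mul, hψpos q hq]
    · rw [ENNReal.div_le_iff hM0 hMtop, mul_comm]
      exact hTf p q hq hNtop
end

section
/- Let H:(0,∞)→[0,∞) be measurable with φ_H(p) := ∫_0^∞ z^{−1/p} H(z) dz < ∞ for every p ∈ (1,∞), and suppose H satisfies either the hypotheses of Lemma 1a (H(z) = H_− |log z|^{β1} S1(|log z|)(1+O(|log z|^{−γ})) as z→0+ with H_−>0, β1≥0, S1 slowly varying, and ∫_1^∞ z^{−1+δ0}H(z)dz < ∞ for some δ0>0) or of Lemma 1b (H(z) = H_+ z^{−1}(log z)^{β2} S2(log z)(1+O((log z)^{−γ})) as z→∞ with H_+>0, β2≥0, S2 slowly varying, and ∫_0^1 z^{−δ0}H(z)dz < ∞ for some δ0>0). Define the operator T_H f(x) = ∫_0^∞ x^{−1} H(y/x) f(y) dy on (0,∞) with Lebesgue measure, and for ψ ∈ Ψ(1,∞) set ψ_(φ)(p) = φ_H(p) ψ(p).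 Then for every ψ ∈ Ψ(1,∞) and every f, ||T_H f||G(ψ_(φ)) ≤ ||f||G(ψ), and the constant 1 is exact: sup_{ψ∈Ψ(1,∞)} sup_{f≠0} ||T_H f||G(ψ_(φ)) / ||f||G(ψ) = 1. -/
open MeasureTheory Real Set Filter ENNReal Asymptotics

/-- A nonnegative continuous function on `(0,∞)` that is slowly varying at infinity. -/
def SlowlyVarying (S : ℝ → ℝ) : Prop :=
  ContinuousOn S (Set.Ioi 0) ∧ (∀ z ∈ Set.Ioi (0:ℝ), 0 ≤ S z) ∧
    ∀ l : ℝ, 0 < l → Tendsto (fun z => S (l * z) / S z) atTop (nhds 1)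

/-- Hypotheses of Lemma 1a. -/
def Lemma1aHyp (H : ℝ → ℝ) : Prop :=
  (∃ δ0 : ℝ, 0 < δ0 ∧ IntegrableOn (fun z => z ^ (-1 + δ0) * H z) (Set.Ioi 1)) ∧
  ∃ Hm β1 γ : ℝ, 0 < Hm ∧ 0 ≤ β1 ∧ 0 < γ ∧ ∃ S1 : ℝ → ℝ, SlowlyVarying S1 ∧
    ∃ E : ℝ → ℝ,
      (∀ᶠ z in nhdsWithin 0 (Set.Ioi 0),
        H z = Hm * |Real.log z| ^ β1 * S1 |Real.log z| * (1 + E z)) ∧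
      E =O[nhdsWithin 0 (Set.Ioi 0)] fun z => |Real.log z| ^ (-γ)

/-- Hypotheses of Lemma 1b. -/
def Lemma1bHyp (H : ℝ → ℝ) : Prop :=
  (∃ δ0 : ℝ, 0 < δ0 ∧ IntegrableOn (fun z => z ^ (-δ0) * H z) (Set.Ioo 0 1)) ∧
  ∃ Hp β2 γ : ℝ, 0 < Hp ∧ 0 ≤ β2 ∧ 0 < γ ∧ ∃ S2 : ℝ → ℝ, SlowlyVarying S2 ∧
    ∃ E : ℝ → ℝ,
      (∀ᶠ z in atTop,
        H z = Hp * z⁻¹ * Real.log z ^ β2 * S2 (Real.log z) * (1 + E z)) ∧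
      E =O[atTop] fun z => Real.log z ^ (-γ)

/-- `ψ ∈ Ψ(I)`: continuous, positive, with positive infimum on the exponent set `I`. -/
def PsiClass (I : Set ℝ) (ψ : ℝ → ℝ) : Prop :=
  ContinuousOn ψ I ∧ (∀ p ∈ I, 0 < ψ p) ∧ ∃ ε > 0, ∀ p ∈ I, ε ≤ ψ p

/-- The Bilateral Grand Lebesgue norm `sup_{p ∈ I} |f|_p / ψ(p)` over `(0,∞)`. -/
noncomputable def BGLS (I : Set ℝ) (ψ : ℝ → ℝ) (f : ℝ → ℝ) : ℝ≥0∞ :=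
  ⨆ p ∈ I, eLpNorm f (ENNReal.ofReal p) (volume.restrict (Set.Ioi 0)) /
    ENNReal.ofReal (ψ p)

lemma lintegral_Ioi_zero_eq_mul_comp_mul_left {a : ℝ} (ha : 0 < a) (F : ℝ → ℝ≥0∞) :
    ∫⁻ y in Ioi (0 : ℝ), F y = ENNReal.ofReal a * ∫⁻ z in Ioi (0 : ℝ), F (a * z) := by
  have himg : (fun z : ℝ => a * z) '' Ioi 0 = Ioi 0 := by
    rw [image_mul_left_Ioi ha, mul_zero]
  have h := lintegral_image_eq_lintegral_abs_deriv_mul (s := Ioi (0 : ℝ)) (f := fun z => a * z)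
    (f' := fun _ => a) measurableSet_Ioi
    (fun x _ => by simpa using ((hasDerivAt_id x).const_mul a).hasDerivWithinAt)
    (fun x _ y _ hxy => mul_left_cancel₀ ha.ne' hxy) F
  rw [himg, abs_of_pos ha, lintegral_const_mul' _ _ ENNReal.ofReal_ne_top] at h
  exact h

/-- The `L^p` bound on `(0,∞)` for multiplicative convolution with a nonnegative kernel. -/
lemma lintegral_rpow_lintegral_comp_mul_le {p : ℝ} (hp : 1 < p) {k G : ℝ → ℝ≥0∞}
    (hk : Measurable k) (hG : Measurable G) :
    ∫⁻ x in Ioi (0 : ℝ), (∫⁻ z in Ioi (0 : ℝ), k z * G (x * z)) ^ p ≤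
      (∫⁻ z in Ioi (0 : ℝ), ENNReal.ofReal (z ^ (-(1 / p))) * k z) ^ p *
        ∫⁻ x in Ioi (0 : ℝ), G x ^ p := by
  have hp0 : 0 < p := one_pos.trans hp
  obtain ⟨q, hpq⟩ : ∃ q, p.HolderConjugate q := ⟨_, Real.HolderConjugate.conjExponent hp⟩
  set μ : Measure ℝ := volume.restrict (Ioi 0) with hμ
  set m : ℝ → ℝ≥0∞ := fun z => ENNReal.ofReal (z ^ (-(1 / p))) * k z with hm
  have hmm : Measurable m := by fun_prop
  set ν : Measure ℝ := μ.withDensity m with hν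
  have hmass : ν univ = ∫⁻ z, m z ∂μ := by
    rw [hν, withDensity_apply _ MeasurableSet.univ, Measure.restrict_univ]
  have hpos : ∀ᵐ z ∂ν, z ∈ Ioi (0 : ℝ) :=
    (withDensity_absolutelyContinuous μ m).ae_le (ae_restrict_mem measurableSet_Ioi)
  have hinner : ∀ x, (∫⁻ z, k z * G (x * z) ∂μ) ^ p ≤
      (∫⁻ z, ENNReal.ofReal z * G (x * z) ^ p ∂ν) * ν univ ^ (p - 1) := by
    intro x
    have hGx : Measurable fun z => G (x * z) := hG.comp (measurable_const_mul x)
    have h1 : ∫⁻ z, k z * G (x * z) ∂μ =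
        ∫⁻ z, ENNReal.ofReal (z ^ (1 / p)) * G (x * z) ∂ν := by
      rw [hν, lintegral_withDensity_eq_lintegral_mul _ hmm (by fun_prop)]
      refine setLIntegral_congr_fun measurableSet_Ioi fun z hz => ?_
      have hz : (0 : ℝ) < z := hz
      have : ENNReal.ofReal (z ^ (-(1 / p))) * ENNReal.ofReal (z ^ (1 / p)) = 1 := by
        rw [← ENNReal.ofReal_mul (by positivity), ← Real.rpow_add hz]; simp
      simp only [hm, Pi.mul_apply]
      calc k z * G (x * z) = 1 * (k z * G (x * z)) := (one_mul _).symm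
        _ = _ := by rw [← this]; ring
    have h2 := ENNReal.lintegral_mul_le_Lp_mul_Lq ν hpq
      (f := fun z => ENNReal.ofReal (z ^ (1 / p)) * G (x * z)) (g := fun _ => 1)
      (by fun_prop) (by fun_prop)
    have h3 : ∫⁻ z, (ENNReal.ofReal (z ^ (1 / p)) * G (x * z)) ^ p ∂ν =
        ∫⁻ z, ENNReal.ofReal z * G (x * z) ^ p ∂ν := by
      refine lintegral_congr_ae (hpos.mono fun z hz => ?_)
      have hz : (0 : ℝ) < z := hz
      simp only
      rw [ENNReal.mul_rpow_of_nonneg _ _ hp0.le,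
        ENNReal.ofReal_rpow_of_nonneg (by positivity) hp0.le, ← Real.rpow_mul hz.le,
        one_div_mul_cancel hp0.ne', Real.rpow_one]
    have hq : 1 / q * p = p - 1 := by
      rw [one_div_mul_eq_div, hpq.div_conj_eq_sub_one]
    rw [h1]
    simp only [Pi.mul_def, mul_one, ENNReal.one_rpow, lintegral_one] at h2
    calc _ ≤ _ := ENNReal.rpow_le_rpow h2 hp0.le
      _ = _ := by
        rw [ENNReal.mul_rpow_of_nonneg _ _ hp0.le, ← ENNReal.rpow_mul, ← ENNReal.rpow_mul,
          one_div_mul_cancel hp0.ne', ENNReal.rpow_one, hq, h3]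
  have hmeas : Measurable fun w : ℝ × ℝ => ENNReal.ofReal w.2 * G (w.1 * w.2) ^ p := by
    fun_prop
  calc ∫⁻ x, (∫⁻ z, k z * G (x * z) ∂μ) ^ p ∂μ
      ≤ ∫⁻ x, (∫⁻ z, ENNReal.ofReal z * G (x * z) ^ p ∂ν) * ν univ ^ (p - 1) ∂μ :=
        lintegral_mono hinner
    _ = (∫⁻ x, ∫⁻ z, ENNReal.ofReal z * G (x * z) ^ p ∂ν ∂μ) * ν univ ^ (p - 1) :=
        lintegral_mul_const _ hmeas.lintegral_prod_right'
    _ = (∫⁻ z, ∫⁻ x, ENNReal.ofReal z * G (x * z) ^ p ∂μ ∂ν) * ν univ ^ (p - 1) := by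
        rw [lintegral_lintegral_swap hmeas.aemeasurable]
    _ = (∫⁻ _, ∫⁻ x, G x ^ p ∂μ ∂ν) * ν univ ^ (p - 1) := by
        congr 1
        refine lintegral_congr_ae (hpos.mono fun z hz => ?_)
        have := lintegral_Ioi_zero_eq_mul_comp_mul_left hz fun y => G y ^ p
        simp only [hμ]
        rw [this, lintegral_const_mul' _ _ ENNReal.ofReal_ne_top]
        simp only [mul_comm z]
    _ = _ := by
        rw [lintegral_const, ← hmass, mul_assoc, mul_comm]
        congr 1
        nth_rewrite 1 [← ENNReal.rpow_one (ν univ)]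
        rw [← ENNReal.rpow_add_of_nonneg _ _ zero_le_one (by linarith)]
        congr 1; ring

/-- A function with finite lower integral has a largest measurable minorant, up to null sets. -/
lemma exists_measurable_le_lintegral_eq_forall_ae_le {α : Type*} [MeasurableSpace α]
    {μ : Measure α} {F : α → ℝ≥0∞} (hF : ∫⁻ a, F a ∂μ ≠ ∞) :
    ∃ g : α → ℝ≥0∞, Measurable g ∧ g ≤ F ∧ ∫⁻ a, F a ∂μ = ∫⁻ a, g a ∂μ ∧
      ∀ u : α → ℝ≥0∞, AEMeasurable u μ → u ≤ᵐ[μ] F → u ≤ᵐ[μ] g := by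
  obtain ⟨g, hg, hgF, hgF_int⟩ := exists_measurable_le_lintegral_eq μ F
  refine ⟨g, hg, hgF, hgF_int, fun u hu huF => ?_⟩
  have hle : g ≤ᵐ[μ] fun a => max (u a) (g a) := Eventually.of_forall fun a => le_max_right _ _
  have hmax : ∫⁻ a, max (u a) (g a) ∂μ ≤ ∫⁻ a, g a ∂μ := by
    rw [← hgF_int]
    exact lintegral_mono_ae (huF.mono fun a ha => max_le ha (hgF a))
  filter_upwards [ae_eq_of_ae_le_of_lintegral_le hle (hgF_int ▸ hF) (hu.max hg.aemeasurable) hmax]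
    with a ha
  exact (le_max_left _ _).trans ha.ge

lemma eLpNorm_integral_homogeneous_kernel_le {H : ℝ → ℝ} (hHmeas : Measurable H)
    (hHnn : ∀ z ∈ Ioi (0 : ℝ), 0 ≤ H z) {p : ℝ} (hp : 1 < p)
    (hfin : IntegrableOn (fun z => z ^ (-(1 / p)) * H z) (Ioi 0)) {f : ℝ → ℝ}
    (hf : eLpNorm f (ENNReal.ofReal p) (volume.restrict (Ioi 0)) ≠ ∞) :
    eLpNorm (fun x => ∫ y in Ioi (0 : ℝ), x⁻¹ * H (y / x) * f y) (ENNReal.ofReal p)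
        (volume.restrict (Ioi 0)) ≤
      ENNReal.ofReal (∫ z in Ioi (0 : ℝ), z ^ (-(1 / p)) * H z) *
        eLpNorm f (ENNReal.ofReal p) (volume.restrict (Ioi 0)) := by
  have hp0 : 0 < p := one_pos.trans hp
  have hpE : ENNReal.ofReal p ≠ 0 := by simpa using hp0
  have hfp : ∫⁻ x in Ioi (0 : ℝ), ‖f x‖ₑ ^ p ≠ ∞ := by
    have := lintegral_rpow_enorm_lt_top_of_eLpNorm_lt_top hpE ENNReal.ofReal_ne_top hf.lt_top
    rw [ENNReal.toReal_ofReal hp0.le] at this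
    exact this.ne
  obtain ⟨g, hg, -, hgF_int, hmax⟩ := exists_measurable_le_lintegral_eq_forall_ae_le hfp
  set k : ℝ → ℝ≥0∞ := fun z => ENNReal.ofReal (H z) with hk
  set G : ℝ → ℝ≥0∞ := fun y => g y ^ (1 / p) with hGdef
  have hkm : Measurable k := hHmeas.ennreal_ofReal
  have hG : Measurable G := hg.pow_const _
  have hGp : ∀ y, G y ^ p = g y := fun y => by
    simp only [hGdef]
    rw [← ENNReal.rpow_mul, one_div_mul_cancel hp0.ne', ENNReal.rpow_one]
  have hpt : ∀ x ∈ Ioi (0 : ℝ), ‖∫ y in Ioi (0 : ℝ), x⁻¹ * H (y / x) * f y‖ₑ ≤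
      ∫⁻ z in Ioi (0 : ℝ), k z * G (x * z) := by
    intro x hx
    have hx : 0 < x := hx
    by_cases hm : AEStronglyMeasurable (fun y => x⁻¹ * H (y / x) * f y)
        (volume.restrict (Ioi 0))
    swap
    · rw [integral_non_aestronglyMeasurable hm]; simp
    have hdom : ∀ᵐ y ∂(volume.restrict (Ioi (0 : ℝ))), ‖x⁻¹ * H (y / x) * f y‖ₑ ≤
        ENNReal.ofReal x⁻¹ * (k (y / x) * G y) := by
      have hle := hmax
        (fun y => (‖x⁻¹ * H (y / x) * f y‖ₑ * (‖x⁻¹ * H (y / x)‖ₑ)⁻¹) ^ p)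
        (by
          have h1 : Measurable fun y => (‖x⁻¹ * H (y / x)‖ₑ)⁻¹ := by fun_prop
          exact (hm.enorm.mul h1.aemeasurable).pow_const _)
        (Eventually.of_forall fun y => by
          refine ENNReal.rpow_le_rpow ?_ hp0.le
          rw [enorm_mul, mul_right_comm]
          exact mul_le_of_le_one_left' (ENNReal.mul_inv_le_one _))
      filter_upwards [hle, ae_restrict_mem measurableSet_Ioi] with y hy hy0
      have hyx : 0 < y / x := div_pos hy0 hx
      have hc : ‖x⁻¹ * H (y / x)‖ₑ = ENNReal.ofReal x⁻¹ * k (y / x) := by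
        rw [Real.enorm_of_nonneg (mul_nonneg (by positivity) (hHnn _ hyx)),
          ENNReal.ofReal_mul (by positivity)]
      rw [← mul_assoc, ← hc]
      rcases eq_or_ne (x⁻¹ * H (y / x)) 0 with h0 | h0
      · simp [h0]
      · rw [← hGp, ENNReal.rpow_le_rpow_iff hp0, ← div_eq_mul_inv] at hy
        exact (ENNReal.div_le_iff' (by simpa using h0) enorm_ne_top).1 hy
    calc _ ≤ _ := enorm_integral_le_lintegral_enorm _
      _ ≤ _ := lintegral_mono_ae hdom
      _ = _ := by
        rw [lintegral_const_mul' _ _ ENNReal.ofReal_ne_top,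
          lintegral_Ioi_zero_eq_mul_comp_mul_left hx, ← mul_assoc,
          ← ENNReal.ofReal_mul (by positivity), inv_mul_cancel₀ hx.ne', ENNReal.ofReal_one,
          one_mul]
        simp [mul_div_cancel_left₀ _ hx.ne']
  have hφ : ∫⁻ z in Ioi (0 : ℝ), ENNReal.ofReal (z ^ (-(1 / p))) * k z =
      ENNReal.ofReal (∫ z in Ioi (0 : ℝ), z ^ (-(1 / p)) * H z) := by
    rw [ofReal_integral_eq_lintegral_ofReal hfin]
    · refine setLIntegral_congr_fun measurableSet_Ioi fun z hz => ?_
      exact (ENNReal.ofReal_mul (Real.rpow_nonneg (le_of_lt hz) _)).symm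
    · filter_upwards [ae_restrict_mem measurableSet_Ioi] with z hz
      exact mul_nonneg (Real.rpow_nonneg (le_of_lt hz) _) (hHnn z hz)
  rw [eLpNorm_eq_lintegral_rpow_enorm_toReal hpE ENNReal.ofReal_ne_top,
    eLpNorm_eq_lintegral_rpow_enorm_toReal hpE ENNReal.ofReal_ne_top,
    ENNReal.toReal_ofReal hp0.le, hgF_int, ← hφ]
  calc _ ≤ (∫⁻ x in Ioi (0 : ℝ), (∫⁻ z in Ioi (0 : ℝ), k z * G (x * z)) ^ p) ^ (1 / p) := by
        refine ENNReal.rpow_le_rpow ?_ (by positivity)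
        exact setLIntegral_mono' measurableSet_Ioi fun x hx =>
          ENNReal.rpow_le_rpow (hpt x hx) hp0.le
    _ ≤ _ := ENNReal.rpow_le_rpow (lintegral_rpow_lintegral_comp_mul_le hp hkm hG)
          (by positivity)
    _ = _ := by
        rw [ENNReal.mul_rpow_of_nonneg _ _ (by positivity), ← ENNReal.rpow_mul,
          mul_one_div_cancel hp0.ne', ENNReal.rpow_one]
        simp only [hGp]

lemma SlowlyVarying.eventually_pos {S : ℝ → ℝ} (hS : SlowlyVarying S) :
    ∀ᶠ z in atTop, 0 < S z := by
  have h1 := (hS.2.2 1 one_pos).eventually_ne one_ne_zero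
  filter_upwards [h1, eventually_gt_atTop 0] with z hz hz0
  refine lt_of_le_of_ne (hS.2.1 z hz0) fun h => hz ?_
  rw [← h, _root_.div_zero]

lemma eventually_pos_of_asymptotic {l : Filter ℝ} {H L E S : ℝ → ℝ} {c β γ : ℝ} (hc : 0 < c)
    (hγ : 0 < γ) (hS : SlowlyVarying S) (hL : Tendsto L l atTop)
    (hH : ∀ᶠ z in l, H z = c * L z ^ β * S (L z) * (1 + E z))
    (hE : E =O[l] fun z => L z ^ (-γ)) : ∀ᶠ z in l, 0 < H z := by
  have hE0 : Tendsto E l (nhds 0) := hE.trans_tendsto ((tendsto_rpow_neg_atTop hγ).comp hL)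
  filter_upwards [hH, hL.eventually hS.eventually_pos, hL.eventually (eventually_gt_atTop 0),
    hE0.eventually (lt_mem_nhds (show (-1 : ℝ) < 0 by norm_num))] with z h1 h2 h3 h4
  rw [h1]
  have : 0 < 1 + E z := by linarith
  positivity

lemma Lemma1aHyp.exists_Ioo_pos {H : ℝ → ℝ} (hH : Lemma1aHyp H) :
    ∃ a b : ℝ, 0 ≤ a ∧ a < b ∧ ∀ z ∈ Ioo a b, 0 < H z := by
  obtain ⟨-, c, β, γ, hc, -, hγ, S, hS, E, hHE, hE⟩ := hH
  have hL : Tendsto (fun z => |Real.log z|) (nhdsWithin 0 (Ioi 0)) atTop :=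
    tendsto_abs_atBot_atTop.comp Real.tendsto_log_nhdsGT_zero
  have hpos := eventually_pos_of_asymptotic hc hγ hS hL hHE hE
  obtain ⟨b, hb, hsub⟩ := mem_nhdsGT_iff_exists_Ioo_subset.1 hpos
  exact ⟨0, b, le_rfl, hb, fun z hz => hsub hz⟩

lemma Lemma1bHyp.exists_Ioo_pos {H : ℝ → ℝ} (hH : Lemma1bHyp H) :
    ∃ a b : ℝ, 0 ≤ a ∧ a < b ∧ ∀ z ∈ Ioo a b, 0 < H z := by
  obtain ⟨-, c, β, γ, hc, -, hγ, S, hS, E, hHE, hE⟩ := hH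
  have hpos := eventually_pos_of_asymptotic (H := fun z => z * H z) (β := β) hc hγ hS
    Real.tendsto_log_atTop (by
      filter_upwards [hHE, eventually_gt_atTop 0] with z hz hz0
      rw [hz]; field_simp) hE
  obtain ⟨R, hR⟩ := eventually_atTop.1 (hpos.and (eventually_gt_atTop 0))
  refine ⟨max R 0, max R 0 + 1, le_max_right _ _, by linarith, fun z hz => ?_⟩
  obtain ⟨h1, h2⟩ := hR z ((le_max_left _ _).trans hz.1.le)
  exact pos_of_mul_pos_right h1 h2.le

lemma setIntegral_rpow_mul_pos {H : ℝ → ℝ} (hHnn : ∀ z ∈ Ioi (0 : ℝ), 0 ≤ H z)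
    (hpos : ∃ a b : ℝ, 0 ≤ a ∧ a < b ∧ ∀ z ∈ Ioo a b, 0 < H z) {s : ℝ}
    (hfin : IntegrableOn (fun z => z ^ s * H z) (Ioi 0)) :
    0 < ∫ z in Ioi (0 : ℝ), z ^ s * H z := by
  obtain ⟨a, b, ha, hab, hH⟩ := hpos
  rw [setIntegral_pos_iff_support_of_nonneg_ae _ hfin]
  · refine lt_of_lt_of_le (b := volume (Ioo a b)) (by simpa using hab) (measure_mono ?_)
    intro z hz
    have hz0 : 0 < z := ha.trans_lt hz.1
    exact ⟨(mul_pos (Real.rpow_pos_of_pos hz0 _) (hH z hz)).ne', hz0⟩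
  · filter_upwards [ae_restrict_mem measurableSet_Ioi] with z hz
    exact mul_nonneg (Real.rpow_nonneg (le_of_lt hz) _) (hHnn z hz)

/-- The function `x ^ (-1/2)` truncated to `[a, b]`. -/
noncomputable def truncInvSqrt (a b : ℝ) : ℝ → ℝ :=
  (Icc a b).indicator fun x => x ^ (-(1 / 2) : ℝ)

/-- The `p`-th power of the `L^p` norm of `truncInvSqrt a b`, for `0 < a ≤ b`. The `max` makes
the integrand jointly continuous in `x` and `p`. -/
noncomputable def truncInvSqrtMoment (a b p : ℝ) : ℝ :=
  ∫ x in a..b, (max x a ^ (-(1 / 2) : ℝ)) ^ p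

lemma eLpNorm_truncInvSqrt {a b p : ℝ} (ha : 0 < a) (hab : a ≤ b) (hp : 0 < p) :
    eLpNorm (truncInvSqrt a b) (ENNReal.ofReal p) (volume.restrict (Ioi 0)) =
      ENNReal.ofReal (truncInvSqrtMoment a b p ^ (1 / p)) := by
  have hpE : ENNReal.ofReal p ≠ 0 := by simpa using hp
  have hmax : ∀ x, 0 < max x a := fun x => lt_max_of_lt_right ha
  have hcont : Continuous fun x : ℝ => (max x a ^ (-(1 / 2) : ℝ)) ^ p :=
    ((continuous_id.max continuous_const).rpow_const fun x => Or.inl (hmax x).ne').rpow_const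
      fun x => Or.inr hp.le
  have hnn : ∀ x : ℝ, 0 ≤ (max x a ^ (-(1 / 2) : ℝ)) ^ p := fun x =>
    Real.rpow_nonneg (Real.rpow_nonneg (hmax x).le _) _
  have hM : 0 ≤ truncInvSqrtMoment a b p :=
    intervalIntegral.integral_nonneg hab fun x _ => hnn x
  rw [eLpNorm_eq_lintegral_rpow_enorm_toReal hpE ENNReal.ofReal_ne_top,
    ENNReal.toReal_ofReal hp.le, ← ENNReal.ofReal_rpow_of_nonneg hM (by positivity)]
  congr 1
  rw [truncInvSqrtMoment, intervalIntegral.integral_of_le hab, ← integral_Icc_eq_integral_Ioc,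
    ofReal_integral_eq_lintegral_ofReal hcont.integrableOn_Icc (Eventually.of_forall hnn)]
  have hind : ∀ x, ‖truncInvSqrt a b x‖ₑ ^ p =
      (Icc a b).indicator (fun x => ENNReal.ofReal ((max x a ^ (-(1 / 2) : ℝ)) ^ p)) x := by
    intro x
    by_cases hx : x ∈ Icc a b
    · have hx0 : 0 < x := ha.trans_le hx.1
      simp only [truncInvSqrt, indicator_of_mem hx, max_eq_left hx.1]
      rw [Real.enorm_of_nonneg (by positivity),
        ENNReal.ofReal_rpow_of_nonneg (by positivity) hp.le]
    · simp [truncInvSqrt, indicator_of_notMem hx, hp]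
  simp only [hind]
  rw [lintegral_indicator measurableSet_Icc, Measure.restrict_restrict measurableSet_Icc,
    inter_eq_left.2 (show Icc a b ⊆ Ioi 0 from fun x hx => ha.trans_le hx.1)]

lemma truncInvSqrtMoment_two {a b : ℝ} (ha : 0 < a) (hab : a ≤ b) :
    truncInvSqrtMoment a b 2 = Real.log (b / a) := by
  rw [truncInvSqrtMoment, ← integral_inv_of_pos ha (ha.trans_le hab)]
  refine intervalIntegral.integral_congr fun x hx => ?_
  rw [uIcc_of_le hab] at hx
  have hx0 : 0 < x := ha.trans_le hx.1
  simp only [max_eq_left hx.1]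
  rw [← Real.rpow_mul hx0.le, ← Real.rpow_neg_one]
  norm_num

lemma psiClass_truncInvSqrtMoment {N : ℝ} (hN : 2 ≤ N) :
    PsiClass (Ioi 1) fun p => truncInvSqrtMoment 1 N p ^ (1 / p) := by
  have hmax : ∀ x : ℝ, 0 < max x 1 := fun x => lt_max_of_lt_right one_pos
  have hjoint : Continuous fun w : ℝ × ℝ => (max w.2 1 ^ (-(1 / 2) : ℝ)) ^ w.1 :=
    ((continuous_snd.max continuous_const).rpow_const fun w => Or.inl (hmax _).ne').rpow
      continuous_fst fun w => Or.inl (Real.rpow_pos_of_pos (hmax _) _).ne'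
  have hM : Continuous (truncInvSqrtMoment 1 N) :=
    intervalIntegral.continuous_parametric_intervalIntegral_of_continuous' hjoint 1 N
  have hN0 : 0 < N := by linarith
  have hlow : ∀ p ∈ Ioi (1 : ℝ), (N ^ (-(1 / 2) : ℝ)) ^ p ≤ truncInvSqrtMoment 1 N p := by
    intro p hp
    have hp0 : 0 < p := one_pos.trans hp
    have h1 : (N - 1) * (N ^ (-(1 / 2) : ℝ)) ^ p ≤ truncInvSqrtMoment 1 N p := by
      rw [truncInvSqrtMoment, ← smul_eq_mul, ← intervalIntegral.integral_const]
      refine intervalIntegral.integral_mono_on (by linarith) (by simp)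
        ((hjoint.comp (Continuous.prodMk_right p)).intervalIntegrable _ _) fun x hx => ?_
      have hx0 : 0 < x := one_pos.trans_le hx.1
      rw [max_eq_left hx.1]
      exact Real.rpow_le_rpow (by positivity)
        (Real.rpow_le_rpow_of_nonpos hx0 hx.2 (by norm_num)) hp0.le
    refine le_trans (le_mul_of_one_le_left (by positivity) (by linarith)) h1
  have hlow' : ∀ p ∈ Ioi (1 : ℝ),
      N ^ (-(1 / 2) : ℝ) ≤ truncInvSqrtMoment 1 N p ^ (1 / p) := by
    intro p hp
    have hp0 : 0 < p := one_pos.trans hp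
    calc N ^ (-(1 / 2) : ℝ) = ((N ^ (-(1 / 2) : ℝ)) ^ p) ^ (1 / p) := by
          rw [← Real.rpow_mul (by positivity), mul_one_div_cancel hp0.ne', Real.rpow_one]
      _ ≤ _ := Real.rpow_le_rpow (by positivity) (hlow p hp) (by positivity)
  have hε : 0 < N ^ (-(1 / 2) : ℝ) := by positivity
  refine ⟨?_, fun p hp => hε.trans_le (hlow' p hp), _, hε, hlow'⟩
  refine hM.continuousOn.rpow (continuousOn_const.div continuousOn_id fun p hp => ?_)
    fun p hp => Or.inl ?_
  · exact (one_pos.trans hp).ne'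
  · exact ((Real.rpow_pos_of_pos hε p).trans_le (hlow p hp)).ne'

lemma mul_setIntegral_le_integral_truncInvSqrt {H : ℝ → ℝ}
    (hHnn : ∀ z ∈ Ioi (0 : ℝ), 0 ≤ H z)
    (hfin : IntegrableOn (fun z => z ^ (-(1 / 2) : ℝ) * H z) (Ioi 0)) {M N x : ℝ} (hM : 0 < M)
    (hMx : M ≤ x) (hxN : x ≤ N / M) :
    (∫ z in Icc M⁻¹ M, z ^ (-(1 / 2) : ℝ) * H z) * x ^ (-(1 / 2) : ℝ) ≤
      ∫ y in Ioi (0 : ℝ), x⁻¹ * H (y / x) * truncInvSqrt 1 N y := by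
  have hx : 0 < x := hM.trans_le hMx
  have hsub : Icc x⁻¹ (N / x) ⊆ Ioi 0 := fun z hz => (inv_pos.2 hx).trans_le hz.1
  have hsub' : Icc M⁻¹ M ⊆ Icc x⁻¹ (N / x) := by
    refine Icc_subset_Icc (inv_anti₀ hM hMx) ?_
    rw [le_div_iff₀ hx, mul_comm]
    exact (le_div_iff₀ hM).1 hxN
  have hrw : ∫ y in Ioi (0 : ℝ), x⁻¹ * H (y / x) * truncInvSqrt 1 N y =
      ∫ z in Ioi (0 : ℝ), (Icc x⁻¹ (N / x)).indicator
        (fun z => z ^ (-(1 / 2) : ℝ) * H z * x ^ (-(1 / 2) : ℝ)) z := by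
    have h := integral_comp_mul_left_Ioi (fun y => H (y / x) * truncInvSqrt 1 N y) 0 hx
    simp only [mul_assoc]
    rw [integral_const_mul]
    rw [mul_zero, smul_eq_mul] at h
    rw [← h]
    refine setIntegral_congr_fun measurableSet_Ioi fun z hz => ?_
    have hz : 0 < z := hz
    have hiff : x * z ∈ Icc 1 N ↔ z ∈ Icc x⁻¹ (N / x) := by
      simp only [mem_Icc, inv_le_iff_one_le_mul₀' hx, le_div_iff₀' hx]
    simp only [mul_div_cancel_left₀ _ hx.ne']
    by_cases hm : z ∈ Icc x⁻¹ (N / x)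
    · rw [indicator_of_mem hm, truncInvSqrt, indicator_of_mem (hiff.2 hm),
        Real.mul_rpow hx.le hz.le]
      ring
    · rw [indicator_of_notMem hm, truncInvSqrt, indicator_of_notMem (mt hiff.1 hm), mul_zero]
  rw [hrw, setIntegral_indicator measurableSet_Icc, inter_eq_right.2 hsub, integral_mul_const]
  refine mul_le_mul_of_nonneg_right ?_ (by positivity)
  refine setIntegral_mono_set (hfin.mono_set hsub) ?_ hsub'.eventuallyLE
  filter_upwards [ae_restrict_mem measurableSet_Icc] with z hz
  exact mul_nonneg (Real.rpow_nonneg (le_of_lt (hsub hz)) _) (hHnn z (hsub hz))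

lemma ofReal_mul_sqrt_log_le_eLpNorm {H : ℝ → ℝ}
    (hHnn : ∀ z ∈ Ioi (0 : ℝ), 0 ≤ H z)
    (hfin : IntegrableOn (fun z => z ^ (-(1 / 2) : ℝ) * H z) (Ioi 0)) {M N : ℝ} (hM : 0 < M)
    (hMN : M ≤ N / M) :
    ENNReal.ofReal ((∫ z in Icc M⁻¹ M, z ^ (-(1 / 2) : ℝ) * H z) * √(Real.log (N / M / M))) ≤
      eLpNorm (fun x => ∫ y in Ioi (0 : ℝ), x⁻¹ * H (y / x) * truncInvSqrt 1 N y)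
        (ENNReal.ofReal 2) (volume.restrict (Ioi 0)) := by
  set c := ∫ z in Icc M⁻¹ M, z ^ (-(1 / 2) : ℝ) * H z with hc
  have hpos : ∀ z ∈ Icc M⁻¹ M, 0 < z := fun z hz => (inv_pos.2 hM).trans_le hz.1
  have hc0 : 0 ≤ c := setIntegral_nonneg measurableSet_Icc fun z hz =>
    mul_nonneg (Real.rpow_nonneg (hpos z hz).le _) (hHnn z (hpos z hz))
  have h := eLpNorm_truncInvSqrt hM hMN two_pos
  rw [truncInvSqrtMoment_two hM hMN, ← Real.sqrt_eq_rpow] at h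
  rw [ENNReal.ofReal_mul hc0, ← h, ← Real.enorm_of_nonneg hc0, ← eLpNorm_const_smul]
  refine eLpNorm_mono fun x => ?_
  by_cases hx : x ∈ Icc M (N / M)
  · have hx0 : 0 < x := hM.trans_le hx.1
    rw [Pi.smul_apply, smul_eq_mul, truncInvSqrt, indicator_of_mem hx,
      Real.norm_of_nonneg (by positivity)]
    exact (mul_setIntegral_le_integral_truncInvSqrt hHnn hfin hM hx.1 hx.2).trans
      (le_abs_self _)
  · rw [Pi.smul_apply, truncInvSqrt, indicator_of_notMem hx, smul_zero, norm_zero]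
    exact norm_nonneg _

/-- Theorem 3: `‖T_H f‖G(ψ_(φ)) ≤ ‖f‖G(ψ)`, and the constant `1` is exact. -/
theorem homogeneous_kernel_operator_exact_constant_one
    (H : ℝ → ℝ) (hHmeas : Measurable H) (hHnn : ∀ z ∈ Set.Ioi (0:ℝ), 0 ≤ H z)
    (hfin : ∀ p ∈ Set.Ioi (1:ℝ),
      IntegrableOn (fun z => z ^ (-(1/p)) * H z) (Set.Ioi 0))
    (hH : Lemma1aHyp H ∨ Lemma1bHyp H)
    (φ : ℝ → ℝ) (hφ : ∀ p, φ p = ∫ z in Set.Ioi (0:ℝ), z ^ (-(1/p)) * H z)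
    (T : (ℝ → ℝ) → ℝ → ℝ)
    (hT : ∀ f x, T f x = ∫ y in Set.Ioi (0:ℝ), x⁻¹ * H (y / x) * f y) :
    (∀ ψ : ℝ → ℝ, PsiClass (Set.Ioi 1) ψ → ∀ f : ℝ → ℝ,
      BGLS (Set.Ioi 1) (fun p => φ p * ψ p) (T f) ≤ BGLS (Set.Ioi 1) ψ f) ∧
    (⨆ ψ : ℝ → ℝ, ⨆ _ : PsiClass (Set.Ioi 1) ψ, ⨆ f : ℝ → ℝ, ⨆ _ : f ≠ 0,
      BGLS (Set.Ioi 1) (fun p => φ p * ψ p) (T f) / BGLS (Set.Ioi 1) ψ f) = 1 := by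
  have hTf : ∀ f, T f = fun x => ∫ y in Ioi (0 : ℝ), x⁻¹ * H (y / x) * f y :=
    fun f => funext (hT f)
  have hφpos : ∀ p ∈ Ioi (1 : ℝ), 0 < φ p := fun p hp => by
    rw [hφ]
    exact setIntegral_rpow_mul_pos hHnn
      (hH.elim Lemma1aHyp.exists_Ioo_pos Lemma1bHyp.exists_Ioo_pos) (hfin p hp)
  have hbound : ∀ ψ : ℝ → ℝ, PsiClass (Set.Ioi 1) ψ → ∀ f : ℝ → ℝ,
      BGLS (Set.Ioi 1) (fun p => φ p * ψ p) (T f) ≤ BGLS (Set.Ioi 1) ψ f := by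
    intro ψ hψ f
    refine iSup₂_mono fun p hp => ?_
    have hφE : ENNReal.ofReal (φ p) ≠ 0 := by simpa using hφpos p hp
    rcases eq_or_ne (eLpNorm f (ENNReal.ofReal p) (volume.restrict (Ioi 0))) ∞ with hf | hf
    · rw [hf, ENNReal.top_div_of_ne_top ENNReal.ofReal_ne_top]
      exact le_top
    · rw [ENNReal.ofReal_mul (hφpos p hp).le,
        ← ENNReal.mul_div_mul_left _ (ENNReal.ofReal (ψ p)) hφE ENNReal.ofReal_ne_top, hTf, hφ]
      exact ENNReal.div_le_div_right
        (eLpNorm_integral_homogeneous_kernel_le hHmeas hHnn hp (hfin p hp) hf) _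
  refine ⟨hbound, le_antisymm ?_ ?_⟩
  · refine iSup₂_le fun ψ hψ => iSup₂_le fun f _ => ENNReal.div_le_of_le_mul ?_
    rw [one_mul]
    exact hbound ψ hψ f
  have h2 : (2 : ℝ) ∈ Ioi (1 : ℝ) := mem_Ioi.2 _root_.one_lt_two
  have hφ2 := hφpos 2 h2
  set c : ℕ → ℝ := fun m =>
    ∫ z in Icc (Real.exp m)⁻¹ (Real.exp m), z ^ (-(1 / 2) : ℝ) * H z with hc
  have hclim : Tendsto c atTop (nhds (φ 2)) := by
    have hexp : Tendsto (fun m : ℕ => Real.exp m) atTop atTop :=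
      Real.tendsto_exp_atTop.comp tendsto_natCast_atTop_atTop
    have := ((aecover_Ioi_of_Ici hexp.inv_tendsto_atTop).inter
      (aecover_Iic hexp)).integral_tendsto_of_countably_generated (hfin 2 h2)
    rw [hφ]
    refine this.congr fun m => ?_
    have hsub : Icc (Real.exp m)⁻¹ (Real.exp m) ⊆ Ioi 0 := fun z hz =>
      (inv_pos.2 (Real.exp_pos _)).trans_le hz.1
    simp only [Pi.inv_apply, Ici_inter_Iic]
    rw [Measure.restrict_restrict measurableSet_Icc, inter_eq_left.2 hsub]
  have hlim : Tendsto (fun m : ℕ => ENNReal.ofReal (c m / φ 2 * √(1 - 2 / m))) atTop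
      (nhds 1) := by
    rw [← ENNReal.ofReal_one]
    refine ENNReal.tendsto_ofReal ?_
    have h1 : Tendsto (fun m : ℕ => c m / φ 2) atTop (nhds 1) := by
      simpa [hφ2.ne'] using hclim.div_const (φ 2)
    have h3 : Tendsto (fun m : ℕ => √(1 - 2 / (m : ℝ))) atTop (nhds 1) := by
      have := (tendsto_const_div_atTop_nhds_zero_nat (2 : ℝ)).const_sub 1
      simpa using this.sqrt
    simpa using h1.mul h3
  refine le_of_tendsto hlim ((eventually_ge_atTop 2).mono fun m hm => ?_)
  have hm' : (2 : ℝ) ≤ m := by exact_mod_cast hm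
  have hm0 : (0 : ℝ) < m := by linarith
  set N : ℝ := Real.exp ((m : ℝ) ^ 2) with hN
  have hN2 : 2 ≤ N := by
    have := Real.add_one_le_exp ((m : ℝ) ^ 2)
    nlinarith
  set ψ : ℝ → ℝ := fun p => truncInvSqrtMoment 1 N p ^ (1 / p) with hψdef
  have hψ : PsiClass (Ioi 1) ψ := psiClass_truncInvSqrtMoment hN2
  have hnorm : ∀ p ∈ Ioi (1 : ℝ), eLpNorm (truncInvSqrt 1 N) (ENNReal.ofReal p)
      (volume.restrict (Ioi 0)) = ENNReal.ofReal (ψ p) := fun p hp =>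
    eLpNorm_truncInvSqrt one_pos (by linarith) (one_pos.trans hp)
  have hψ2 : ψ 2 = m := by
    rw [hψdef]
    simp only
    rw [truncInvSqrtMoment_two one_pos (by linarith), div_one, hN, Real.log_exp,
      ← Real.sqrt_eq_rpow, Real.sqrt_sq hm0.le]
  have hf0 : truncInvSqrt 1 N ≠ 0 := fun h => by
    have := congrFun h 1
    rw [truncInvSqrt, indicator_of_mem (show (1 : ℝ) ∈ Icc 1 N from ⟨le_rfl, by linarith⟩)] at this
    simp at this
  have hf1 : BGLS (Ioi 1) ψ (truncInvSqrt 1 N) ≤ 1 :=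
    iSup₂_le fun p hp => by rw [hnorm p hp]; exact ENNReal.div_self_le_one
  have hquot : N / Real.exp m / Real.exp m = Real.exp ((m : ℝ) ^ 2 - 2 * m) := by
    rw [hN, ← Real.exp_sub, ← Real.exp_sub]; ring_nf
  have hlow := ofReal_mul_sqrt_log_le_eLpNorm hHnn (hfin 2 h2) (M := Real.exp m) (N := N)
    (Real.exp_pos _) (by
      rw [hN, ← Real.exp_sub]; exact Real.exp_le_exp.2 (by nlinarith))
  rw [hquot, Real.log_exp, ← hTf] at hlow
  calc ENNReal.ofReal (c m / φ 2 * √(1 - 2 / m))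
      = ENNReal.ofReal (c m * √((m : ℝ) ^ 2 - 2 * m)) / ENNReal.ofReal (φ 2 * ψ 2) := by
        rw [← ENNReal.ofReal_div_of_pos (by rw [hψ2]; positivity), hψ2]
        have : √((m : ℝ) ^ 2 - 2 * m) = m * √(1 - 2 / m) := by
          rw [← Real.sqrt_sq hm0.le, ← Real.sqrt_mul (by positivity), Real.sqrt_sq hm0.le]
          congr 1; field_simp
        rw [this]
        congr 1; field_simp
    _ ≤ eLpNorm (T (truncInvSqrt 1 N)) (ENNReal.ofReal 2) (volume.restrict (Ioi 0)) /
          ENNReal.ofReal (φ 2 * ψ 2) := ENNReal.div_le_div_right hlow _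
    _ ≤ BGLS (Ioi 1) (fun p => φ p * ψ p) (T (truncInvSqrt 1 N)) :=
        le_iSup₂_of_le (f := fun p (_ : p ∈ Ioi (1 : ℝ)) =>
          eLpNorm (T (truncInvSqrt 1 N)) (ENNReal.ofReal p) (volume.restrict (Ioi 0)) /
            ENNReal.ofReal (φ p * ψ p)) 2 h2 le_rfl
    _ ≤ BGLS (Ioi 1) (fun p => φ p * ψ p) (T (truncInvSqrt 1 N)) /
          BGLS (Ioi 1) ψ (truncInvSqrt 1 N) := by
        nth_rewrite 1 [← _root_.div_one (BGLS (Ioi 1) (fun p => φ p * ψ p) _)]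
        exact ENNReal.div_le_div_left hf1 _
    _ ≤ _ := by
        refine le_iSup₂_of_le ψ hψ (le_iSup_of_le (truncInvSqrt 1 N) ?_)
        exact le_iSup_of_le hf0 le_rfl
end

section
/- Let α ∈ (0,1) and define U_α[f](x) = x^{−α} ∫_0^x s^{α−1} f(s) ds on (0,∞) with Lebesgue measure, for which the Hardy-type inequality |U_α[f]|_p ≤ (α − 1/p)^{−1} |f|_p holds for all p ∈ (1/α, ∞). For ψ ∈ Ψ(1/α,∞) define ψ_α(p) = (α − 1/p)^{−1} ψ(p). Then ||U_α[f]||G(ψ_α) ≤ 1 · ||f||G(ψ) for every ψ ∈ Ψ(1/α,∞) and every f, and the constant 1 is exact: sup_{ψ∈Ψ(1/α,∞)} sup_{f≠0} ||U_α[f]||G(ψ_α) / ||f||G(ψ) = 1. -/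
open MeasureTheory Real Set Filter ENNReal

theorem setIntegral_Ioo_rpow_sub_one {α x : ℝ} (hα : 0 < α) (hx : 0 < x) :
    ∫ s in Ioo (0 : ℝ) x, s ^ (α - 1) = x ^ α / α := by
  rw [← integral_Ioc_eq_integral_Ioo, ← intervalIntegral.integral_of_le hx.le,
    integral_rpow (Or.inl (by linarith)), sub_add_cancel, zero_rpow hα.ne', sub_zero]

theorem eLpNorm_indicator_Ioo_zero_one (c p : ℝ) (hp : 0 < p) :
    eLpNorm ((Ioo (0 : ℝ) 1).indicator fun _ => c) (ENNReal.ofReal p)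
      (volume.restrict (Ioi 0)) = ‖c‖ₑ := by
  have h : volume.restrict (Ioi (0 : ℝ)) (Ioo 0 1) = 1 := by
    rw [Measure.restrict_apply measurableSet_Ioo, inter_eq_left.mpr fun x hx => hx.1]
    simp
  rw [eLpNorm_indicator_const measurableSet_Ioo (by simpa using hp) ofReal_ne_top, h]
  simp

theorem BGLS_le_of_forall_eLpNorm_le {I : Set ℝ} {ψ c : ℝ → ℝ} {f g : ℝ → ℝ}
    (hc : ∀ p ∈ I, 0 < c p)
    (h : ∀ p ∈ I, eLpNorm g (ENNReal.ofReal p) (volume.restrict (Ioi 0)) ≤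
      ENNReal.ofReal (c p) * eLpNorm f (ENNReal.ofReal p) (volume.restrict (Ioi 0))) :
    BGLS I (fun p => c p * ψ p) g ≤ BGLS I ψ f := by
  refine iSup₂_mono fun p hp => ?_
  rw [ENNReal.ofReal_mul (hc p hp).le]
  exact (ENNReal.div_le_div_right (h p hp) _).trans_eq
    (ENNReal.mul_div_mul_left _ _ (by simpa using hc p hp) ofReal_ne_top)

theorem psiClass_one (I : Set ℝ) : PsiClass I fun _ => 1 :=
  ⟨continuousOn_const, fun _ _ => one_pos, 1, one_pos, fun _ _ => le_rfl⟩

theorem BGLS_one_indicator_le {I : Set ℝ} (hI : ∀ p ∈ I, 0 < p) :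
    BGLS I (fun _ => 1) ((Ioo (0 : ℝ) 1).indicator fun _ => 1) ≤ 1 := by
  refine iSup₂_le fun p hp => ?_
  rw [eLpNorm_indicator_Ioo_zero_one 1 p (hI p hp)]
  simp

theorem one_le_BGLS_of_eq_inv_on_Ioo {α : ℝ} (hα : 0 < α) {g : ℝ → ℝ}
    (hg : ∀ x ∈ Ioo (0 : ℝ) 1, g x = α⁻¹) :
    1 ≤ BGLS (Ioi (1 / α)) (fun p => (α - 1 / p)⁻¹ * 1) g := by
  have hlim : Tendsto (fun p : ℝ => ENNReal.ofReal (α⁻¹ * (α - 1 / p))) atTop (nhds 1) := by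
    have h : Tendsto (fun p : ℝ => α - 1 / p) atTop (nhds α) := by
      simpa using (tendsto_inv_atTop_zero (𝕜 := ℝ)).const_sub α
    simpa [hα.ne'] using ENNReal.tendsto_ofReal (h.const_mul α⁻¹)
  refine le_of_tendsto hlim ?_
  filter_upwards [eventually_gt_atTop (1 / α)] with p hp
  have hp0 : 0 < p := (one_div_pos.mpr hα).trans hp
  have hpos : 0 < α - 1 / p := sub_pos.mpr ((one_div_lt hα hp0).mp hp)
  refine le_iSup₂_of_le p hp ?_
  have hnorm : ENNReal.ofReal α⁻¹ ≤
      eLpNorm g (ENNReal.ofReal p) (volume.restrict (Ioi 0)) := by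
    rw [← Real.enorm_of_nonneg (inv_pos.mpr hα).le,
      ← eLpNorm_indicator_Ioo_zero_one α⁻¹ p hp0, ← indicator_congr hg]
    exact eLpNorm_indicator_le g
  simp only [mul_one]
  rw [ENNReal.ofReal_inv_of_pos hpos, ENNReal.div_eq_inv_mul, inv_inv, mul_comm α⁻¹,
    ENNReal.ofReal_mul hpos.le]
  gcongr

/-- Theorem 8: for `U_α f(x) = x^{-α} ∫_0^x s^{α-1} f(s) ds`, with
`ψ_α(p) = (α - 1/p)^{-1} ψ(p)`, one has `‖U_α f‖G(ψ_α) ≤ ‖f‖G(ψ)` and the constant `1`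
is exact. -/
theorem U_alpha_bgls_exact_constant_one
    (α : ℝ) (hα : α ∈ Set.Ioo (0:ℝ) 1)
    (U : (ℝ → ℝ) → ℝ → ℝ)
    (hU : ∀ f x, U f x = x ^ (-α) * ∫ s in Set.Ioo (0:ℝ) x, s ^ (α - 1) * f s)
    -- the Hardy-type inequality `|U_α f|_p ≤ (α - 1/p)⁻¹ |f|_p` for `p ∈ (1/α,∞)`
    (hHardy : ∀ p ∈ Set.Ioi (1/α), ∀ f : ℝ → ℝ,
      eLpNorm (U f) (ENNReal.ofReal p) (volume.restrict (Set.Ioi 0)) ≤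
        ENNReal.ofReal ((α - 1/p)⁻¹) *
          eLpNorm f (ENNReal.ofReal p) (volume.restrict (Set.Ioi 0))) :
    -- the BGLS estimate with constant `1`
    (∀ ψ : ℝ → ℝ, PsiClass (Set.Ioi (1/α)) ψ → ∀ f : ℝ → ℝ,
      BGLS (Set.Ioi (1/α)) (fun p => (α - 1/p)⁻¹ * ψ p) (U f) ≤
        1 * BGLS (Set.Ioi (1/α)) ψ f) ∧
    -- exactness of the constant `1`
    (⨆ ψ : ℝ → ℝ, ⨆ _ : PsiClass (Set.Ioi (1/α)) ψ, ⨆ f : ℝ → ℝ, ⨆ _ : f ≠ 0,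
      BGLS (Set.Ioi (1/α)) (fun p => (α - 1/p)⁻¹ * ψ p) (U f) /
        BGLS (Set.Ioi (1/α)) ψ f) = 1 := by
  have hαpos := hα.1
  have hI : ∀ p ∈ Ioi (1 / α), 0 < p := fun p hp => (one_div_pos.mpr hαpos).trans hp
  have hbound : ∀ ψ f : ℝ → ℝ, BGLS (Ioi (1 / α)) (fun p => (α - 1 / p)⁻¹ * ψ p) (U f) ≤
      BGLS (Ioi (1 / α)) ψ f := fun ψ f =>
    BGLS_le_of_forall_eLpNorm_le
      (fun p hp => inv_pos.mpr (sub_pos.mpr ((one_div_lt hαpos (hI p hp)).mp hp)))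
      fun p hp => hHardy p hp f
  refine ⟨fun ψ _ f => (one_mul (BGLS _ ψ f)).symm ▸ hbound ψ f, le_antisymm ?_ ?_⟩
  · refine iSup₂_le fun ψ _ => iSup₂_le fun f _ => ?_
    exact ENNReal.div_le_of_le_mul ((one_mul (BGLS _ ψ f)).symm ▸ hbound ψ f)
  · have hne : (Ioo (0 : ℝ) 1).indicator (fun _ => (1 : ℝ)) ≠ 0 := fun h => by
      have := congrFun h (1 / 2)
      rw [indicator_of_mem (by norm_num)] at this
      exact one_ne_zero this
    refine le_iSup₂_of_le (fun _ => 1) (psiClass_one _) (le_iSup₂_of_le _ hne ?_)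
    have hU1 : ∀ x ∈ Ioo (0 : ℝ) 1, U ((Ioo (0 : ℝ) 1).indicator fun _ => 1) x = α⁻¹ := by
      intro x hx
      have hcongr : ∫ s in Ioo (0 : ℝ) x,
          s ^ (α - 1) * (Ioo (0 : ℝ) 1).indicator (fun _ => (1 : ℝ)) s =
          ∫ s in Ioo (0 : ℝ) x, s ^ (α - 1) :=
        setIntegral_congr_fun measurableSet_Ioo fun s hs => by
          rw [indicator_of_mem (show s ∈ Ioo (0 : ℝ) 1 from ⟨hs.1, hs.2.trans hx.2⟩), mul_one]
      rw [hU, hcongr, setIntegral_Ioo_rpow_sub_one hαpos hx.1, ← mul_div_assoc,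
        ← rpow_add hx.1, neg_add_cancel, Real.rpow_zero, one_div]
    calc (1 : ℝ≥0∞) = 1 / 1 := by simp
      _ ≤ _ := ENNReal.div_le_div (one_le_BGLS_of_eq_inv_on_Ioo hαpos hU1)
        (BGLS_one_indicator_le hI)
end

section
/- Let α ∈ (0,1) and let A = {a(n,k)} be either the matrix a(n,k) = n^{−α}( k^α − (k−1)^α ) for 1 ≤ k ≤ n (0 otherwise), or a(n,k) = k^{α−1} / Σ_{i=1}^n i^{α−1} for 1 ≤ k ≤ n (0 otherwise), with operator T_A[x](n) = Σ_{k=1}^n a(n,k) x(k); in both cases |T_A|_{p,p} ≤ αp/(αp−1) for p > 1/α. For ψ ∈ Ψ(1/α,∞) set ψ_(α)(p) = αp ψ(p)/(αp−1). Then ||T_A[x]||G(ψ_(α)) ≤ 1 · ||x||G(ψ) for every ψ ∈ Ψ(1/α,∞) and every sequence x, and the constant 1 is exact: sup_{ψ∈Ψ(1/α,∞)} sup_{x≠0} ||T_A[x]||G(ψ_(α)) / ||x||G(ψ) = 1. -/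
open MeasureTheory Real Set Filter ENNReal

/-- The `ℓ^p` norm of a sequence indexed by `{1,2,3,…}`. -/
noncomputable def lpNorm (x : ℕ+ → ℝ) (p : ℝ) : ℝ≥0∞ :=
  (∑' k : ℕ+, ENNReal.ofReal (|x k| ^ p)) ^ (1/p)

/-- The Bilateral Grand Lebesgue norm of a sequence. -/
noncomputable def BGLSseq (I : Set ℝ) (ψ : ℝ → ℝ) (x : ℕ+ → ℝ) : ℝ≥0∞ :=
  ⨆ p ∈ I, lpNorm x p / ENNReal.ofReal (ψ p)

theorem rpow_young_hardy {α p : ℝ} (hα : 0 < α) (hp : 1 < p) (hαp : 1 < α * p)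
    {F x : ℝ} (hF : 0 ≤ F) (hx : 0 ≤ x) :
    (1 - α * p) * F ^ p + α * p * F ^ (p - 1) * x ≤
      (α * p - 1) / p * ((α * p / (α * p - 1)) ^ p * x ^ p - F ^ p) := by
  have hd : 0 < α * p - 1 := by linarith
  have hp0 : 0 < p := by linarith
  set C := α * p / (α * p - 1) with hC
  have hC0 : 0 < C := by positivity
  have hy := Real.young_inequality_of_nonneg (mul_nonneg hC0.le hx) (Real.rpow_nonneg hF (p - 1))
    (Real.HolderConjugate.conjExponent hp)
  rw [← Real.rpow_mul hF, Real.conjExponent, mul_div_cancel₀ _ (by linarith : p - 1 ≠ 0),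
    Real.mul_rpow hC0.le hx] at hy
  have h1 : α * p * F ^ (p - 1) * x = (α * p - 1) * (C * x * F ^ (p - 1)) := by
    rw [hC]; field_simp
  rw [h1]
  have h2 := mul_le_mul_of_nonneg_left hy hd.le
  refine (add_le_add_right h2 _).trans (le_of_eq ?_)
  generalize C ^ p * x ^ p = X
  generalize F ^ p = Y
  field_simp
  ring

theorem hardy_increment_le {α p : ℝ} (hα : 0 < α) (hp : 1 < p) (hαp : 1 < α * p)
    {m x c : ℝ} (hm : 0 < m) (hx : 0 ≤ x) (hc : 0 ≤ c) :
    (m + 1) * (x + c * (m + 1) ^ (-α)) ^ p - m * (x + c * m ^ (-α)) ^ p ≤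
      (α * p - 1) / p * ((α * p / (α * p - 1)) ^ p * x ^ p - (x + c * (m + 1) ^ (-α)) ^ p) := by
  have hder : ∀ s : ℝ, 0 < s → HasDerivAt (fun s : ℝ => s * (x + c * s ^ (-α)) ^ p)
      ((1 - α * p) * (x + c * s ^ (-α)) ^ p + α * p * (x + c * s ^ (-α)) ^ (p - 1) * x) s := by
    intro s hs
    have hF : 0 ≤ x + c * s ^ (-α) := by positivity
    have h1 : HasDerivAt (fun s : ℝ => x + c * s ^ (-α)) (c * (-α * s ^ (-α - 1))) s :=
      ((Real.hasDerivAt_rpow_const (Or.inl hs.ne')).const_mul c).const_add x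
    have h2 := (hasDerivAt_id s).mul (h1.rpow_const (p := p) (Or.inr hp.le))
    refine h2.congr_deriv ?_
    have h3 : s * s ^ (-α - 1) = s ^ (-α) := by
      rw [Real.rpow_sub_one hs.ne']; field_simp
    have h4 : (x + c * s ^ (-α)) ^ p = (x + c * s ^ (-α)) ^ (p - 1) * (x + c * s ^ (-α)) := by
      have := Real.rpow_add_of_nonneg hF (by linarith : 0 ≤ p - 1) zero_le_one
      rwa [sub_add_cancel, Real.rpow_one] at this
    simp only [id]
    rw [h4]
    linear_combination (-α * c * p * (x + c * s ^ (-α)) ^ (p - 1)) * h3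
  obtain ⟨s, ⟨hs1, hs2⟩, hs⟩ := exists_hasDerivAt_eq_slope _ _ (by linarith : m < m + 1)
    (fun s hs => (hder s (hm.trans_le hs.1)).continuousAt.continuousWithinAt)
    (fun s hs => hder s (hm.trans hs.1))
  have hs0 : 0 < s := hm.trans hs1
  rw [add_sub_cancel_left, div_one] at hs
  rw [← hs]
  refine (rpow_young_hardy hα hp hαp (by positivity) hx).trans ?_
  have hd : 0 < α * p - 1 := by linarith
  have hp0 : 0 < p := by linarith
  have hle : (m + 1) ^ (-α) ≤ s ^ (-α) := Real.rpow_le_rpow_of_nonpos hs0 hs2.le (by linarith)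
  gcongr

/-- The weight `(k+1)^α - k^α`, whose first `n` terms sum to `n^α`. -/
noncomputable def alphaWeight (α : ℝ) (k : ℕ) : ℝ := ((k : ℝ) + 1) ^ α - (k : ℝ) ^ α

theorem alphaWeight_nonneg {α : ℝ} (hα : 0 < α) (k : ℕ) : 0 ≤ alphaWeight α k :=
  sub_nonneg.2 (Real.rpow_le_rpow (by positivity) (by linarith) hα.le)

theorem sum_alphaWeight {α : ℝ} (hα : 0 < α) (n : ℕ) :
    ∑ k ∈ Finset.range n, alphaWeight α k = (n : ℝ) ^ α := by
  have := Finset.sum_range_sub (fun k : ℕ => (k : ℝ) ^ α) n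
  simpa [alphaWeight, Real.zero_rpow hα.ne'] using this

theorem antitone_alphaWeight {α : ℝ} (hα : 0 < α) (hα1 : α ≤ 1) : Antitone (alphaWeight α) := by
  refine antitone_nat_of_succ_le fun k => ?_
  have h : 1 / 2 * (k : ℝ) ^ α + 1 / 2 * ((k : ℝ) + 2) ^ α ≤
      (1 / 2 * (k : ℝ) + 1 / 2 * ((k : ℝ) + 2)) ^ α :=
    (Real.concaveOn_rpow hα.le hα1).2 (Set.mem_Ici.2 (by positivity))
      (Set.mem_Ici.2 (by positivity)) (by norm_num) (by norm_num) (by norm_num)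
  rw [show 1 / 2 * (k : ℝ) + 1 / 2 * ((k : ℝ) + 2) = k + 1 by ring] at h
  simp only [alphaWeight]
  push_cast
  rw [show (k : ℝ) + 1 + 1 = k + 2 by ring]
  linarith

theorem hardy_sum_le_of_antitone {α p : ℝ} (hα : 0 < α) (hp : 1 < p) (hαp : 1 < α * p)
    {y : ℕ → ℝ} (hy0 : ∀ k, 0 ≤ y k) (hy : Antitone y) (N : ℕ) :
    ∑ n ∈ Finset.range N,
        ((∑ k ∈ Finset.range (n + 1), alphaWeight α k * y k) / ((n : ℝ) + 1) ^ α) ^ p ≤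
      (α * p / (α * p - 1)) ^ p * ∑ k ∈ Finset.range N, y k ^ p := by
  have hd : 0 < α * p - 1 := by linarith
  have hp0 : 0 < p := by linarith
  set F : ℕ → ℝ := fun n => (∑ k ∈ Finset.range n, alphaWeight α k * y k) / (n : ℝ) ^ α with hFdef
  have hF0 : ∀ n, 0 ≤ F n := fun n => div_nonneg
    (Finset.sum_nonneg fun k _ => mul_nonneg (alphaWeight_nonneg hα k) (hy0 k)) (by positivity)
  have key : ∀ n : ℕ, (n : ℝ) * F n ^ p ≤ (α * p - 1) / p *
      ∑ k ∈ Finset.range n, ((α * p / (α * p - 1)) ^ p * y k ^ p - F (k + 1) ^ p) := by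
    intro n
    induction n with
    | zero => simp
    | succ n ih =>
      rw [Finset.sum_range_succ, mul_add]
      refine le_trans ?_ (add_le_add_left ih _)
      rw [← sub_le_iff_le_add']
      rcases Nat.eq_zero_or_pos n with rfl | hn
      · have h1 : F 1 = y 0 := by simp [hFdef, alphaWeight, Real.zero_rpow hα.ne']
        have h2 := rpow_young_hardy hα hp hαp (hy0 0) (hy0 0)
        have h4 : y 0 ^ p = y 0 ^ (p - 1) * y 0 := by
          have := Real.rpow_add_of_nonneg (hy0 0) (by linarith : 0 ≤ p - 1) zero_le_one
          rwa [sub_add_cancel, Real.rpow_one] at this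
        have h5 : (1 - α * p) * y 0 ^ p + α * p * y 0 ^ (p - 1) * y 0 = y 0 ^ p := by
          linear_combination (-α * p) * h4
        rw [h5] at h2
        simpa [h1] using h2
      · have hn' : (0 : ℝ) < n := by exact_mod_cast hn
        have hnα : 0 < (n : ℝ) ^ α := by positivity
        have hS : ∑ k ∈ Finset.range n, alphaWeight α k * y k = F n * (n : ℝ) ^ α := by
          simp only [hFdef]; field_simp
        have hc : 0 ≤ (F n - y n) * (n : ℝ) ^ α := by
          rw [sub_mul, ← hS, ← sum_alphaWeight hα, Finset.mul_sum, ← Finset.sum_sub_distrib]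
          refine Finset.sum_nonneg fun k hk => ?_
          have := mul_le_mul_of_nonneg_left (hy (Finset.mem_range.1 hk).le) (alphaWeight_nonneg hα k)
          linarith
        have h := hardy_increment_le hα hp hαp hn' (hy0 n) hc
        have e1 : y n + (F n - y n) * (n : ℝ) ^ α * (n : ℝ) ^ (-α) = F n := by
          rw [Real.rpow_neg hn'.le]; field_simp; ring
        have e2 : y n + (F n - y n) * (n : ℝ) ^ α * ((n : ℝ) + 1) ^ (-α) = F (n + 1) := by
          have h0 : F (n + 1) =
              (F n * (n : ℝ) ^ α + alphaWeight α n * y n) / ((n : ℝ) + 1) ^ α := by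
            rw [← hS]; simp only [hFdef, Finset.sum_range_succ]; push_cast; rfl
          have : 0 < ((n : ℝ) + 1) ^ α := by positivity
          rw [h0, Real.rpow_neg (by positivity), alphaWeight]
          field_simp
          ring
        rw [e1, e2] at h
        push_cast
        exact h
  have h := (mul_nonneg (Nat.cast_nonneg N) (Real.rpow_nonneg (hF0 N) p)).trans (key N)
  have h' := nonneg_of_mul_nonneg_right h (by positivity)
  rw [Finset.sum_sub_distrib, ← Finset.mul_sum] at h'
  have e : ∀ n : ℕ, F (n + 1) =
      (∑ k ∈ Finset.range (n + 1), alphaWeight α k * y k) / ((n : ℝ) + 1) ^ α := by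
    intro n; simp only [hFdef]; push_cast; rfl
  simp only [← e]
  linarith

theorem exists_antitone_rearrangement {y : ℕ → ℝ} (hy : ∀ k, 0 ≤ y k) (N : ℕ) :
    ∃ z : ℕ → ℝ, (∀ k, 0 ≤ z k) ∧ Antitone z ∧
      (∀ f : ℝ → ℝ, ∑ k ∈ Finset.range N, f (z k) = ∑ k ∈ Finset.range N, f (y k)) ∧
      ∀ w : ℕ → ℝ, (∀ k, 0 ≤ w k) → Antitone w → ∀ n < N,
        ∑ k ∈ Finset.range (n + 1), w k * y k ≤ ∑ k ∈ Finset.range (n + 1), w k * z k := by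
  set σ := Tuple.sort (fun i : Fin N => -y i) with hσ
  have hmono : Monotone ((fun i : Fin N => -y i) ∘ σ) := Tuple.monotone_sort _
  set z : ℕ → ℝ := fun k => if h : k < N then y (σ ⟨k, h⟩) else 0 with hz
  have hzσ : ∀ i : Fin N, z i = y (σ i) := fun i => by simp [hz]
  refine ⟨z, fun k => ?_, fun i j hij => ?_, fun f => ?_, fun w hw0 hw n hn => ?_⟩
  · simp only [hz]; split_ifs
    · exact hy _
    · exact le_rfl
  · by_cases hj : j < N
    · have hi : i < N := hij.trans_lt hj
      have := hmono (show (⟨i, hi⟩ : Fin N) ≤ ⟨j, hj⟩ from hij)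
      simp only [Function.comp, neg_le_neg_iff] at this
      simpa [hz, hi, hj] using this
    · simp only [hz, hj, dif_neg, not_false_eq_true]; split_ifs
      · exact hy _
      · exact le_rfl
  · rw [← Fin.sum_univ_eq_sum_range (fun k => f (z k)),
      ← Fin.sum_univ_eq_sum_range (fun k => f (y k))]
    simp only [hzσ]
    exact Equiv.sum_comp σ (fun i : Fin N => f (y i))
  · set μ : ℕ → ℝ := fun k => if k < n + 1 then w k else 0 with hμ
    have hμanti : Antitone μ := by
      intro i j hij
      simp only [hμ]
      split_ifs with h1 h2
      · exact hw hij
      · omega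
      · exact hw0 _
      · exact le_rfl
    have hsum : ∀ v : ℕ → ℝ,
        ∑ k ∈ Finset.range (n + 1), w k * v k = ∑ i : Fin N, μ i * v i := by
      intro v
      rw [Fin.sum_univ_eq_sum_range (fun k => μ k * v k)]
      rw [← Finset.sum_subset (Finset.range_subset_range.2 (Nat.succ_le_of_lt hn) :
        Finset.range (n + 1) ⊆ Finset.range N)]
      · exact Finset.sum_congr rfl fun k hk => by simp only [hμ, if_pos (Finset.mem_range.1 hk)]
      · intro k _ hk
        have : ¬ k < n + 1 := by simpa using hk
        simp only [hμ, if_neg this, zero_mul]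
    rw [hsum, hsum]
    have hmv : Monovary (fun i : Fin N => μ i) (fun i : Fin N => y (σ i)) := by
      refine Antitone.monovary (fun i j hij => hμanti hij) (fun i j hij => ?_)
      simpa [Function.comp] using hmono hij
    have := hmv.sum_mul_comp_perm_le_sum_mul (σ := σ⁻¹)
    simpa [hzσ] using this

theorem weighted_chebyshev_sum_le {ι : Type*} (s : Finset ι) {κ r x : ι → ℝ}
    (hκ : ∀ i, 0 ≤ κ i) (h : Monovary r x) :
    (∑ i ∈ s, κ i * r i) * ∑ i ∈ s, κ i * x i ≤
      (∑ i ∈ s, κ i) * ∑ i ∈ s, κ i * r i * x i := by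
  have h0 : 0 ≤ ∑ i ∈ s, ∑ j ∈ s, κ i * κ j * ((r i - r j) * (x i - x j)) := by
    refine Finset.sum_nonneg fun i _ => Finset.sum_nonneg fun j _ =>
      mul_nonneg (mul_nonneg (hκ i) (hκ j)) ?_
    rcases lt_trichotomy (x i) (x j) with hlt | heq | hlt
    · exact mul_nonneg_of_nonpos_of_nonpos (sub_nonpos.2 (h hlt)) (sub_nonpos.2 hlt.le)
    · simp [heq]
    · exact mul_nonneg (sub_nonneg.2 (h hlt)) (sub_nonneg.2 hlt.le)
  have e : ∑ i ∈ s, ∑ j ∈ s, κ i * κ j * ((r i - r j) * (x i - x j)) =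
      (∑ i ∈ s, κ i * r i * x i) * (∑ j ∈ s, κ j) + (∑ i ∈ s, κ i) * (∑ j ∈ s, κ j * r j * x j)
      - (∑ i ∈ s, κ i * r i) * (∑ j ∈ s, κ j * x j)
      - (∑ i ∈ s, κ i * x i) * (∑ j ∈ s, κ j * r j) := by
    simp only [Finset.sum_mul_sum, ← Finset.sum_add_distrib, ← Finset.sum_sub_distrib]
    exact Finset.sum_congr rfl fun i _ => Finset.sum_congr rfl fun j _ => by ring
  linarith

theorem antitone_alphaWeight_div {α : ℝ} (hα : 0 < α) (hα1 : α ≤ 1) :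
    Antitone fun k : ℕ => alphaWeight α k / ((k : ℝ) + 1) ^ (α - 1) := by
  refine antitone_nat_of_succ_le fun k => ?_
  have hform : ∀ t : ℝ, 0 ≤ t → ((t + 1) ^ α - t ^ α) / (t + 1) ^ (α - 1) =
      (t + 1) * (1 - (t / (t + 1)) ^ α) := by
    intro t ht
    have h1 : 0 < t + 1 := by linarith
    have := Real.rpow_pos_of_pos h1 α
    rw [Real.rpow_sub_one h1.ne', Real.div_rpow ht h1.le]
    field_simp
  have hk : (0 : ℝ) ≤ k := Nat.cast_nonneg k
  have hk1 := hform k hk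
  have hk2 := hform (k + 1) (by linarith)
  simp only [alphaWeight]
  push_cast
  rw [hk1, hk2]
  have h : ((k : ℝ) + 1) / (k + 1 + 1) * ((k : ℝ) / (k + 1)) ^ α + 1 / (k + 1 + 1) * 1 ^ α ≤
      (((k : ℝ) + 1) / (k + 1 + 1) * (k / (k + 1)) + 1 / (k + 1 + 1) * 1) ^ α :=
    (Real.concaveOn_rpow hα.le hα1).2 (Set.mem_Ici.2 (by positivity))
      (Set.mem_Ici.2 zero_le_one) (by positivity) (by positivity) (by field_simp)
  rw [Real.one_rpow] at h
  rw [show ((k : ℝ) + 1) / (k + 1 + 1) * (k / (k + 1)) + 1 / (k + 1 + 1) * 1 =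
    (k + 1) / (k + 1 + 1) by field_simp] at h
  have h2 := mul_le_mul_of_nonneg_left h (by linarith : (0 : ℝ) ≤ k + 1 + 1)
  generalize ((k : ℝ) / (k + 1)) ^ α = X at *
  generalize (((k : ℝ) + 1) / (k + 1 + 1)) ^ α = Y at *
  have e : ((k : ℝ) + 1 + 1) * ((k + 1) / (k + 1 + 1) * X + 1 / (k + 1 + 1) * 1) =
    (k + 1) * X + 1 := by field_simp
  rw [e] at h2
  linarith

theorem hardy_alphaWeight_sum_le {α p : ℝ} (hα : 0 < α) (hα1 : α ≤ 1) (hp : 1 < p)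
    (hαp : 1 < α * p) {y : ℕ → ℝ} (hy0 : ∀ k, 0 ≤ y k) (N : ℕ) :
    ∑ n ∈ Finset.range N,
        ((∑ k ∈ Finset.range (n + 1), alphaWeight α k * y k) / ((n : ℝ) + 1) ^ α) ^ p ≤
      (α * p / (α * p - 1)) ^ p * ∑ k ∈ Finset.range N, y k ^ p := by
  obtain ⟨z, hz0, hz, hsum, hle⟩ := exists_antitone_rearrangement hy0 N
  rw [← hsum (fun t => t ^ p)]
  refine le_trans (Finset.sum_le_sum fun n hn => ?_) (hardy_sum_le_of_antitone hα hp hαp hz0 hz N)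
  refine Real.rpow_le_rpow (div_nonneg (Finset.sum_nonneg fun k _ =>
    mul_nonneg (alphaWeight_nonneg hα k) (hy0 k)) (by positivity)) ?_ (by linarith)
  exact div_le_div_of_nonneg_right (hle _ (alphaWeight_nonneg hα) (antitone_alphaWeight hα hα1) n
    (Finset.mem_range.1 hn)) (by positivity)

theorem hardy_rpowWeight_sum_le {α p : ℝ} (hα : 0 < α) (hα1 : α ≤ 1) (hp : 1 < p)
    (hαp : 1 < α * p) {y : ℕ → ℝ} (hy0 : ∀ k, 0 ≤ y k) (N : ℕ) :
    ∑ n ∈ Finset.range N, ((∑ k ∈ Finset.range (n + 1), ((k : ℝ) + 1) ^ (α - 1) * y k) /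
        ∑ k ∈ Finset.range (n + 1), ((k : ℝ) + 1) ^ (α - 1)) ^ p ≤
      (α * p / (α * p - 1)) ^ p * ∑ k ∈ Finset.range N, y k ^ p := by
  obtain ⟨z, hz0, hz, hsum, hle⟩ := exists_antitone_rearrangement hy0 N
  rw [← hsum (fun t => t ^ p)]
  refine le_trans (Finset.sum_le_sum fun n hn => ?_) (hardy_sum_le_of_antitone hα hp hαp hz0 hz N)
  have hκ : ∀ k : ℕ, 0 < ((k : ℝ) + 1) ^ (α - 1) := fun k => by positivity
  have hκa : Antitone fun k : ℕ => ((k : ℝ) + 1) ^ (α - 1) := fun i j hij =>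
    Real.rpow_le_rpow_of_nonpos (by positivity) (by gcongr) (by linarith)
  have hK : 0 < ∑ k ∈ Finset.range (n + 1), ((k : ℝ) + 1) ^ (α - 1) :=
    Finset.sum_pos (fun k _ => hκ k) (by simp)
  refine Real.rpow_le_rpow (div_nonneg (Finset.sum_nonneg fun k _ =>
    mul_nonneg (hκ k).le (hy0 k)) hK.le) ?_ (by linarith)
  refine (div_le_div_of_nonneg_right
    (hle _ (fun k => (hκ k).le) hκa n (Finset.mem_range.1 hn)) hK.le).trans ?_
  have hc := weighted_chebyshev_sum_le (Finset.range (n + 1)) (fun k => (hκ k).le)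
    ((antitone_alphaWeight_div hα hα1).monovary hz)
  have e : ∀ k : ℕ, ((k : ℝ) + 1) ^ (α - 1) * (alphaWeight α k / ((k : ℝ) + 1) ^ (α - 1)) =
    alphaWeight α k := fun k => mul_div_cancel₀ _ (hκ k).ne'
  simp only [e, sum_alphaWeight hα] at hc
  push_cast at hc
  rw [div_le_div_iff₀ hK (by positivity)]
  linarith

theorem sum_Icc_one_succPNat (f : ℕ+ → ℝ) (n : ℕ) :
    ∑ k ∈ Finset.Icc 1 n.succPNat, f k = ∑ k ∈ Finset.range (n + 1), f k.succPNat := by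
  refine Finset.sum_nbij' PNat.natPred Nat.succPNat (fun k hk => ?_) (fun k hk => ?_)
    (fun k _ => PNat.succPNat_natPred k) (fun k _ => Nat.natPred_succPNat k)
    (fun k _ => by rw [PNat.succPNat_natPred])
  · have h := (Finset.mem_Icc.1 hk).2
    have h2 := PNat.natPred_le_natPred.2 h
    rw [Nat.natPred_succPNat] at h2
    exact Finset.mem_range.2 (Nat.lt_succ_of_le h2)
  · exact Finset.mem_Icc.2 ⟨one_le,
      Nat.succPNat_le_succPNat.2 (Nat.le_of_lt_succ (Finset.mem_range.1 hk))⟩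

theorem lpNorm_le_of_sum_range_le {C p : ℝ} (hC : 0 ≤ C) (hp : 0 < p) {u v : ℕ+ → ℝ}
    (h : ∀ N, ∑ n ∈ Finset.range N, |u n.succPNat| ^ p ≤
      C ^ p * ∑ n ∈ Finset.range N, |v n.succPNat| ^ p) :
    _root_.lpNorm u p ≤ ENNReal.ofReal C * _root_.lpNorm v p := by
  have hnn : ∀ (w : ℕ+ → ℝ) k, 0 ≤ |w k| ^ p := fun w k => by positivity
  have hsum : ∑' k : ℕ+, ENNReal.ofReal (|u k| ^ p) ≤
      ENNReal.ofReal C ^ p * ∑' k : ℕ+, ENNReal.ofReal (|v k| ^ p) := by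
    rw [← Equiv.pnatEquivNat.symm.tsum_eq, ← Equiv.pnatEquivNat.symm.tsum_eq]
    refine ENNReal.tsum_le_of_sum_range_le fun N => ?_
    refine le_trans ?_ (mul_le_mul_right (ENNReal.sum_le_tsum (Finset.range N)) _)
    simp only [Equiv.pnatEquivNat_symm_apply]
    rw [ENNReal.ofReal_rpow_of_nonneg hC hp.le,
      ← ENNReal.ofReal_sum_of_nonneg fun _ _ => hnn u _,
      ← ENNReal.ofReal_sum_of_nonneg fun _ _ => hnn v _,
      ← ENNReal.ofReal_mul (by positivity)]
    exact ENNReal.ofReal_le_ofReal (h N)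
  unfold _root_.lpNorm
  refine (ENNReal.rpow_le_rpow hsum (by positivity)).trans (le_of_eq ?_)
  rw [ENNReal.mul_rpow_of_nonneg _ _ (by positivity), ← ENNReal.rpow_mul,
    mul_one_div_cancel hp.ne', ENNReal.rpow_one]

theorem lpNorm_alphaMean_le {α p : ℝ} (hα : α ∈ Set.Ioo (0 : ℝ) 1) (hp : p ∈ Set.Ioi (1 / α))
    {a : ℕ+ → ℕ+ → ℝ}
    (ha : (∀ n k : ℕ+, k ≤ n →
        a n k = (n : ℝ) ^ (-α) * ((k : ℝ) ^ α - ((k : ℝ) - 1) ^ α)) ∨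
      (∀ n k : ℕ+, k ≤ n →
        a n k = (k : ℝ) ^ (α - 1) / ∑ i ∈ Finset.Icc 1 n, (i : ℝ) ^ (α - 1)))
    {T : (ℕ+ → ℝ) → ℕ+ → ℝ}
    (hT : ∀ x n, T x n = ∑ k ∈ Finset.Icc 1 n, a n k * x k) (x : ℕ+ → ℝ) :
    _root_.lpNorm (T x) p ≤ ENNReal.ofReal (α * p / (α * p - 1)) * _root_.lpNorm x p := by
  obtain ⟨hα0, hα1⟩ := hα
  have hαp : 1 < α * p := by
    have := (div_lt_iff₀' hα0).1 (Set.mem_Ioi.1 hp)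
    exact this
  have hp1 : 1 < p := ((one_lt_div hα0).2 hα1).trans hp
  have hd : 0 < α * p - 1 := by linarith
  have hp0 : 0 < p := by linarith
  refine lpNorm_le_of_sum_range_le (by positivity) hp0 fun N => ?_
  have hle : ∀ n : ℕ, ∀ k ∈ Finset.range (n + 1), k.succPNat ≤ n.succPNat := fun n k hk =>
    Nat.succPNat_le_succPNat.2 (Nat.le_of_lt_succ (Finset.mem_range.1 hk))
  have habs : ∀ n : ℕ, |T x n.succPNat| ≤
      ∑ k ∈ Finset.range (n + 1), |a n.succPNat k.succPNat| * |x k.succPNat| := by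
    intro n
    rw [hT, sum_Icc_one_succPNat]
    refine (Finset.abs_sum_le_sum_abs _ _).trans (le_of_eq ?_)
    simp only [abs_mul]
  rcases ha with ha | ha
  · refine le_trans (Finset.sum_le_sum fun n _ => ?_)
      (hardy_alphaWeight_sum_le hα0 hα1.le hp1 hαp (fun k => abs_nonneg (x k.succPNat)) N)
    refine Real.rpow_le_rpow (abs_nonneg _) ((habs n).trans (le_of_eq ?_)) hp0.le
    rw [Finset.sum_div]
    refine Finset.sum_congr rfl fun k hk => ?_
    have e : a n.succPNat k.succPNat = alphaWeight α k / ((n : ℝ) + 1) ^ α := by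
      rw [ha _ _ (hle n k hk), alphaWeight]
      simp only [Nat.succPNat_coe, Nat.succ_eq_add_one]
      push_cast
      rw [Real.rpow_neg (by positivity), add_sub_cancel_right]
      ring
    rw [e, abs_of_nonneg (div_nonneg (alphaWeight_nonneg hα0 k) (by positivity))]
    ring
  · refine le_trans (Finset.sum_le_sum fun n _ => ?_)
      (hardy_rpowWeight_sum_le hα0 hα1.le hp1 hαp (fun k => abs_nonneg (x k.succPNat)) N)
    refine Real.rpow_le_rpow (abs_nonneg _) ((habs n).trans (le_of_eq ?_)) hp0.le
    rw [Finset.sum_div]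
    refine Finset.sum_congr rfl fun k hk => ?_
    have e : a n.succPNat k.succPNat =
        ((k : ℝ) + 1) ^ (α - 1) / ∑ k ∈ Finset.range (n + 1), ((k : ℝ) + 1) ^ (α - 1) := by
      rw [ha _ _ (hle n k hk), sum_Icc_one_succPNat (fun i => (i : ℝ) ^ (α - 1))]
      simp only [Nat.succPNat_coe, Nat.succ_eq_add_one]
      push_cast
      rfl
    rw [e, abs_of_nonneg (div_nonneg (by positivity)
      (Finset.sum_nonneg fun k _ => by positivity))]
    ring

theorem abs_le_lpNorm (x : ℕ+ → ℝ) (k : ℕ+) {p : ℝ} (hp : 0 < p) :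
    ENNReal.ofReal |x k| ≤ _root_.lpNorm x p := by
  unfold _root_.lpNorm
  rw [one_div, ENNReal.le_rpow_inv_iff hp, ENNReal.ofReal_rpow_of_nonneg (abs_nonneg _) hp.le]
  exact ENNReal.le_tsum k

theorem lpNorm_single_one {p : ℝ} (hp : 0 < p) :
    _root_.lpNorm (Pi.single 1 1) p = 1 := by
  unfold _root_.lpNorm
  rw [tsum_eq_single 1 fun k hk => by simp [hk, Real.zero_rpow hp.ne']]
  simp

/-- Theorem 14: for either of the two lower triangular matrices
`a(n,k) = n^{-α}(k^α − (k−1)^α)` or `a(n,k) = k^{α-1}/∑_{i=1}^n i^{α-1}`, with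
`ψ_(α)(p) = αp ψ(p)/(αp−1)`, one has `‖T_A x‖G(ψ_(α)) ≤ ‖x‖G(ψ)` and the constant `1`
is exact. -/
theorem alpha_mean_matrix_bgls_exact_constant_one
    (α : ℝ) (hα : α ∈ Set.Ioo (0:ℝ) 1)
    (a : ℕ+ → ℕ+ → ℝ)
    (ha : (∀ n k : ℕ+, k ≤ n →
        a n k = (n : ℝ) ^ (-α) * ((k : ℝ) ^ α - ((k : ℝ) - 1) ^ α)) ∨
      (∀ n k : ℕ+, k ≤ n →
        a n k = (k : ℝ) ^ (α - 1) / ∑ i ∈ Finset.Icc 1 n, (i : ℝ) ^ (α - 1)))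
    (ha0 : ∀ n k : ℕ+, n < k → a n k = 0)
    (T : (ℕ+ → ℝ) → ℕ+ → ℝ)
    (hT : ∀ x n, T x n = ∑ k ∈ Finset.Icc 1 n, a n k * x k) :
    -- the `ℓ^p → ℓ^p` norm estimate `|T_A|_{p,p} ≤ αp/(αp−1)` for `p > 1/α`
    (∀ p ∈ Set.Ioi (1/α), ∀ x : ℕ+ → ℝ,
      lpNorm (T x) p ≤ ENNReal.ofReal (α * p / (α * p - 1)) * lpNorm x p) ∧
    -- the BGLS estimate with constant `1`
    (∀ ψ : ℝ → ℝ, PsiClass (Set.Ioi (1/α)) ψ → ∀ x : ℕ+ → ℝ,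
      BGLSseq (Set.Ioi (1/α)) (fun p => α * p * ψ p / (α * p - 1)) (T x) ≤
        1 * BGLSseq (Set.Ioi (1/α)) ψ x) ∧
    -- the constant `1` is exact
    (⨆ ψ : ℝ → ℝ, ⨆ _ : PsiClass (Set.Ioi (1/α)) ψ, ⨆ x : ℕ+ → ℝ, ⨆ _ : x ≠ 0,
      BGLSseq (Set.Ioi (1/α)) (fun p => α * p * ψ p / (α * p - 1)) (T x) /
        BGLSseq (Set.Ioi (1/α)) ψ x) = 1 := by
  obtain ⟨hα0, hα1⟩ := id hα
  have hα' : 0 < 1 / α := by positivity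
  have hpos : ∀ p ∈ Set.Ioi (1 / α), 0 < α * p - 1 := fun p hp => by
    have := (div_lt_iff₀' hα0).1 (Set.mem_Ioi.1 hp)
    linarith
  have hbound := fun p hp x => lpNorm_alphaMean_le hα (p := p) hp ha hT x
  have hBGLS : ∀ ψ : ℝ → ℝ, PsiClass (Set.Ioi (1/α)) ψ → ∀ x : ℕ+ → ℝ,
      BGLSseq (Set.Ioi (1/α)) (fun p => α * p * ψ p / (α * p - 1)) (T x) ≤
        BGLSseq (Set.Ioi (1/α)) ψ x := by
    intro ψ hψ x
    refine iSup₂_mono fun p hp => ?_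
    have hd := hpos p hp
    have hp0 : 0 < p := hα'.trans hp
    have hC : 0 < α * p / (α * p - 1) := by positivity
    have e : α * p * ψ p / (α * p - 1) = α * p / (α * p - 1) * ψ p := by ring
    simp only [e]
    rw [ENNReal.ofReal_mul hC.le]
    refine (ENNReal.div_le_div_right (hbound p hp x) _).trans (le_of_eq ?_)
    exact ENNReal.mul_div_mul_left _ _ (by simpa using hC) ENNReal.ofReal_ne_top
  refine ⟨hbound, fun ψ hψ x => by simpa using hBGLS ψ hψ x, le_antisymm ?_ ?_⟩
  · exact iSup₂_le fun ψ hψ => iSup₂_le fun x _ =>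
      ENNReal.div_le_of_le_mul (by simpa using hBGLS ψ hψ x)
  have hψ : PsiClass (Set.Ioi (1 / α)) (fun _ => 1) :=
    ⟨continuousOn_const, fun _ _ => one_pos, 1, one_pos, fun _ _ => le_rfl⟩
  have hx : (Pi.single 1 1 : ℕ+ → ℝ) ≠ 0 := by simp
  refine le_trans ?_ (le_iSup₂_of_le _ hψ (le_iSup₂_of_le _ hx le_rfl))
  have hden : BGLSseq (Set.Ioi (1 / α)) (fun _ => 1) (Pi.single 1 1) ≤ 1 := by
    refine iSup₂_le fun p hp => ?_
    rw [lpNorm_single_one (hα'.trans hp)]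
    simp
  have ha1 : a 1 1 = 1 := by
    rcases ha with ha | ha
    · simp [ha 1 1 le_rfl, Real.zero_rpow hα0.ne']
    · simp [ha 1 1 le_rfl]
  have hT1 : T (Pi.single 1 1) 1 = 1 := by simp [hT, ha1]
  have hnum : 1 ≤ BGLSseq (Set.Ioi (1 / α)) (fun p => α * p * 1 / (α * p - 1))
      (T (Pi.single 1 1)) := by
    have hlim : Tendsto (fun p : ℝ => ENNReal.ofReal (1 - (α * p)⁻¹)) atTop (nhds 1) := by
      have h1 : Tendsto (fun p : ℝ => 1 - (α * p)⁻¹) atTop (nhds (1 - 0)) :=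
        tendsto_const_nhds.sub (tendsto_id.const_mul_atTop hα0).inv_tendsto_atTop
      simpa using ENNReal.tendsto_ofReal h1
    refine le_of_tendsto hlim ?_
    filter_upwards [Ioi_mem_atTop (1 / α)] with p hp
    refine le_trans ?_ (le_iSup₂_of_le p hp le_rfl)
    have hd := hpos p hp
    have hp0 : 0 < p := hα'.trans hp
    have h1 := abs_le_lpNorm (T (Pi.single 1 1)) 1 hp0
    rw [hT1, abs_one, ENNReal.ofReal_one] at h1
    refine le_trans (le_of_eq ?_) (ENNReal.div_le_div_right h1 _)
    rw [one_div, ← ENNReal.ofReal_inv_of_pos (by positivity)]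
    congr 1
    field_simp
  calc (1 : ℝ≥0∞) = 1 / 1 := by simp
    _ ≤ _ := ENNReal.div_le_div hnum hden
end

section
/- Let β ≥ 0 and let S:(0,∞)→[0,∞) be a continuous slowly varying function such that ∫_0^1 z^{−1/p}|log z|^β S(|log z|) dz is finite for p in a right neighborhood of 1. Then, as p → 1+, ∫_0^1 z^{−1/p} |log z|^{β} S(|log z|) dz ∼ Γ(β+1) (p−1)^{−β−1} S( 1/(p−1) ). -/
open MeasureTheory Real Set Filter ENNReal Asymptotics

lemma abs_sub_le_of_tendsto_sub {h : ℝ → ℝ} (hc : Continuous h)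
    (hlim : ∀ u, Tendsto (fun x => h (x + u) - h x) atTop (nhds 0)) {δ : ℝ} (hδ : 0 < δ) :
    ∃ A, ∀ x ≥ A, ∀ u ≥ 0, |h (x + u) - h x| ≤ 2 + δ * u := by
  let E : ℕ → Set ℝ := fun n => {u | ∀ x ≥ (n : ℝ), |h (x + u) - h x| ≤ 1}
  have hE : ∀ n, IsClosed (E n) := fun n => by
    simp only [E, Set.ofPred_forall]
    exact isClosed_iInter fun x => isClosed_iInter fun _ =>
      isClosed_le (by fun_prop) continuous_const
  have hU : ⋃ n, E n = univ := by
    refine eq_univ_of_forall fun u => mem_iUnion.2 ?_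
    have h1 := (hlim u).abs
    rw [abs_zero] at h1
    obtain ⟨B, hB⟩ := eventually_atTop.1 (h1.eventually (ge_mem_nhds one_pos))
    obtain ⟨n, hn⟩ := exists_nat_ge B
    exact ⟨n, fun x hx => hB x (hn.trans hx)⟩
  obtain ⟨n, a, ha⟩ := nonempty_interior_of_iUnion_of_closed hE hU
  obtain ⟨ε, hε, hball⟩ := Metric.mem_nhds_iff.1 (mem_interior_iff_mem_nhds.1 ha)
  obtain ⟨η, hη, hηε⟩ := exists_between hε
  have hstep : ∀ y ≥ n + a, ∀ v, 0 ≤ v → v ≤ η → |h (y + v) - h y| ≤ 2 := by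
    intro y hy v hv hvη
    have h1 : a + v ∈ E n := hball (by
      rw [Metric.mem_ball, Real.dist_eq, add_sub_cancel_left, abs_of_nonneg hv]; linarith)
    have h2 : a ∈ E n := hball (Metric.mem_ball_self hε)
    have h1 := h1 (y - a) (by linarith)
    have h2 := h2 (y - a) (by linarith)
    rw [show y - a + (a + v) = y + v by ring] at h1
    rw [show y - a + a = y by ring] at h2
    rw [abs_le] at *
    constructor <;> linarith [h1.1, h1.2, h2.1, h2.2]
  have h1 := (hlim η).abs
  rw [abs_zero] at h1
  obtain ⟨B, hB⟩ := eventually_atTop.1 (h1.eventually (ge_mem_nhds (mul_pos hδ hη)))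
  have hiter : ∀ k : ℕ, ∀ x ≥ B, |h (x + k * η) - h x| ≤ k * (δ * η) := by
    intro k x hx
    induction k with
    | zero => simp
    | succ k ih =>
      have h2 := hB (x + k * η) (by have := mul_nonneg k.cast_nonneg hη.le; linarith)
      have h3 := abs_add_le (h (x + k * η + η) - h (x + k * η)) (h (x + k * η) - h x)
      rw [sub_add_sub_cancel] at h3
      push_cast
      rw [show x + (k + 1) * η = x + k * η + η by ring]
      linarith
  refine ⟨max B (n + a), fun x hx u hu => ?_⟩
  have hk := Nat.floor_le (div_nonneg hu hη.le)
  have hk' := Nat.lt_floor_add_one (u / η)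
  set k := ⌊u / η⌋₊
  rw [le_div_iff₀ hη] at hk
  rw [div_lt_iff₀ hη] at hk'
  have hxB := (le_max_left _ _).trans hx
  have hxn := (le_max_right _ _).trans hx
  have h2 := hiter k x hxB
  have h3 := hstep (x + k * η) (by have := mul_nonneg k.cast_nonneg hη.le; linarith)
    (u - k * η) (by linarith) (by linarith)
  rw [show x + k * η + (u - k * η) = x + u by ring] at h3
  have h4 := abs_add_le (h (x + u) - h (x + k * η)) (h (x + k * η) - h x)
  rw [sub_add_sub_cancel] at h4
  have h5 := mul_le_mul_of_nonneg_left hk hδ.le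
  linarith

/-- Potter's bounds for slowly varying functions. -/
lemma SlowlyVarying.potter {S : ℝ → ℝ} (hS : SlowlyVarying S) {δ : ℝ} (hδ : 0 < δ) :
    ∃ A > 0, (∀ x ≥ A, 0 < S x) ∧ ∀ x ≥ A, ∀ y ≥ x,
      S y ≤ exp 2 * (y / x) ^ δ * S x ∧ S x ≤ exp 2 * (y / x) ^ δ * S y := by
  obtain ⟨B, hB⟩ := eventually_atTop.1 hS.eventually_pos
  let h : ℝ → ℝ := fun x => log (S (max (exp x) (max B 1)))
  have hpos : ∀ x, 0 < max x (max B 1) := fun x =>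
    lt_max_of_lt_right (lt_max_of_lt_right one_pos)
  have hSpos : ∀ x, 0 < S (max x (max B 1)) := fun x =>
    hB _ ((le_max_left B 1).trans (le_max_right _ _))
  have hc : Continuous h := by
    refine Continuous.log ?_ fun x => (hSpos _).ne'
    exact hS.1.comp_continuous (by fun_prop) fun x => hpos _
  have hlim : ∀ u, Tendsto (fun x => h (x + u) - h x) atTop (nhds 0) := by
    intro u
    have h1 := ((hS.2.2 (exp u) (exp_pos u)).comp tendsto_exp_atTop).log one_ne_zero
    rw [Real.log_one] at h1
    refine h1.congr' ?_
    have h2 : Tendsto (fun x => exp (x + u)) atTop atTop :=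
      tendsto_exp_atTop.comp (tendsto_atTop_add_const_right _ _ tendsto_id)
    filter_upwards [h2.eventually_ge_atTop (max B 1),
      tendsto_exp_atTop.eventually_ge_atTop (max B 1)] with x hx1 hx2
    have e1 := hSpos (exp (x + u))
    have e2 := hSpos (exp x)
    simp only [h, max_eq_left hx1, max_eq_left hx2, Function.comp] at *
    rw [log_div (by rw [← exp_add, add_comm]; exact e1.ne') e2.ne', ← exp_add, add_comm u x]
  obtain ⟨A, hA⟩ := abs_sub_le_of_tendsto_sub hc hlim hδ
  refine ⟨max (exp A) (max B 1), hpos _, fun x hx => ?_, fun x hx y hy => ?_⟩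
  · exact hB x (((le_max_left B 1).trans (le_max_right _ _)).trans hx)
  have hx1 := (le_max_right _ _).trans hx
  have hxA := (le_max_left _ _).trans hx
  have hx0 : 0 < x := (hpos _).trans_le hx
  have hy0 := hx0.trans_le hy
  have sx := hSpos x
  have sy := hSpos y
  have h1 := hA (log x) ((le_log_iff_exp_le hx0).2 hxA) (log y - log x)
    (sub_nonneg.2 (log_le_log hx0 hy))
  simp only [h, add_sub_cancel, exp_log hx0, exp_log hy0] at h1
  rw [max_eq_left hx1] at h1 sx
  rw [max_eq_left (hx1.trans hy)] at h1 sy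
  have e : exp 2 * (y / x) ^ δ = exp (2 + δ * (log y - log x)) := by
    rw [exp_add, rpow_def_of_pos (div_pos hy0 hx0), log_div hy0.ne' hx0.ne', mul_comm δ]
  rw [abs_le] at h1
  constructor
  · calc S y = exp (log (S y)) := (exp_log sy).symm
      _ ≤ exp (2 + δ * (log y - log x) + log (S x)) := exp_le_exp.2 (by linarith)
      _ = _ := by rw [e, exp_add _ (log (S x)), exp_log sx]
  · calc S x = exp (log (S x)) := (exp_log sx).symm
      _ ≤ exp (2 + δ * (log y - log x) + log (S y)) := exp_le_exp.2 (by linarith)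
      _ = _ := by rw [e, exp_add _ (log (S y)), exp_log sy]

lemma SlowlyVarying.tendsto_rpow_mul_atTop {S : ℝ → ℝ} (hS : SlowlyVarying S) {a : ℝ}
    (ha : 0 < a) : Tendsto (fun z => z ^ a * S z) atTop atTop := by
  obtain ⟨A, hA, hpos, hP⟩ := hS.potter (half_pos ha)
  have h1 : Tendsto (fun z : ℝ => z ^ (a / 2) * (exp (-2) * A ^ (a / 2) * S A)) atTop atTop :=
    (tendsto_rpow_atTop (half_pos ha)).atTop_mul_const
      (mul_pos (by positivity) (hpos A le_rfl))
  refine tendsto_atTop_mono' _ ?_ h1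
  filter_upwards [eventually_ge_atTop A] with z hz
  have hz0 := hA.trans_le hz
  have h2 := (hP A le_rfl z hz).2
  rw [div_rpow hz0.le hA.le] at h2
  have hA' := rpow_pos_of_pos hA (a / 2)
  have hz' := rpow_pos_of_pos hz0 (a / 2)
  calc z ^ (a / 2) * (exp (-2) * A ^ (a / 2) * S A)
      ≤ z ^ (a / 2) * (exp (-2) * A ^ (a / 2) *
          (exp 2 * (z ^ (a / 2) / A ^ (a / 2)) * S z)) := by gcongr
    _ = (exp (-2) * exp 2) * (z ^ (a / 2) * z ^ (a / 2)) * S z := by field_simp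
    _ = z ^ a * S z := by
      rw [← exp_add, ← rpow_add hz0, add_halves]; simp

lemma integrableOn_rpow_mul_exp_neg_mul {s b : ℝ} (hs : -1 < s) (hb : 0 < b) :
    IntegrableOn (fun x => x ^ s * exp (-b * x)) (Ioi 0) := by
  simpa using integrableOn_rpow_mul_exp_neg_mul_rpow (p := 1) hs one_pos hb

lemma SlowlyVarying.tendsto_integral_scaled {S : ℝ → ℝ} (hS : SlowlyVarying S) {β : ℝ}
    (hβ : -1 < β) : ∃ A > 0, Tendsto (fun z => ∫ u in Ioi (0 : ℝ),
      exp (-(z * u / (z + 1))) * u ^ β * ((Ici A).indicator S (z * u) / S z)) atTop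
      (nhds (Gamma (β + 1))) := by
  set δ := (β + 1) / 2 with hδ
  have hδ0 : 0 < δ := by linarith
  obtain ⟨A, hA, hpos, hP⟩ := hS.potter hδ0
  refine ⟨A, hA, ?_⟩
  rw [Gamma_eq_integral (by linarith)]
  have hmeas : Measurable ((Ici A).indicator S) := by
    classical
    rw [← piecewise_eq_indicator]
    exact (hS.1.mono fun x hx => hA.trans_le hx).measurable_piecewise
      continuousOn_const measurableSet_Ici
  refine tendsto_integral_filter_of_dominated_convergence
    (fun u => exp 2 * (u ^ (β + δ) * exp (-(1 / 2) * u) + u ^ (β - δ) * exp (-(1 / 2) * u)))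
    (Eventually.of_forall fun z => ?_) ?_ ?_ ?_
  · have := hmeas.comp (measurable_const_mul z)
    refine Measurable.aestronglyMeasurable ?_
    exact (by fun_prop : Measurable fun u : ℝ => exp (-(z * u / (z + 1))) * u ^ β).mul
      (this.div_const _)
  · filter_upwards [eventually_ge_atTop A, eventually_ge_atTop 1] with z hzA hz1
    refine (ae_restrict_iff' measurableSet_Ioi).2 (Eventually.of_forall fun u (hu : 0 < u) => ?_)
    have hz0 : 0 < z := hA.trans_le hzA
    have hSz := hpos z hzA
    have hT0 : 0 ≤ (Ici A).indicator S (z * u) := indicator_nonneg (fun x hx => (hpos x hx).le) _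
    have hT : (Ici A).indicator S (z * u) / S z ≤ exp 2 * (u ^ δ + u ^ (-δ)) := by
      rw [div_le_iff₀ hSz]
      by_cases hzu : z * u ∈ Ici A
      · rw [indicator_of_mem hzu]
        rcases le_total 1 u with h | h
        · have h2 := (hP z hzA (z * u) (le_mul_of_one_le_right hz0.le h)).1
          rw [mul_div_cancel_left₀ _ hz0.ne'] at h2
          refine h2.trans ?_
          gcongr
          exact le_add_of_nonneg_right (by positivity)
        · have h2 := (hP (z * u) hzu z (mul_le_of_le_one_right hz0.le h)).2
          rw [div_mul_cancel_left₀ hz0.ne', inv_rpow hu.le, ← rpow_neg hu.le] at h2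
          refine h2.trans ?_
          gcongr
          exact le_add_of_nonneg_left (by positivity)
      · rw [indicator_of_notMem hzu]
        positivity
    have hexp : exp (-(z * u / (z + 1))) ≤ exp (-(1 / 2) * u) := by
      rw [exp_le_exp, neg_mul, neg_le_neg_iff, le_div_iff₀ (by linarith)]
      nlinarith
    rw [norm_of_nonneg (by positivity)]
    calc _ ≤ exp (-(1 / 2) * u) * u ^ β * (exp 2 * (u ^ δ + u ^ (-δ))) := by gcongr
      _ = _ := by rw [sub_eq_add_neg, rpow_add hu, rpow_add hu]; ring
  · exact ((integrableOn_rpow_mul_exp_neg_mul (by linarith) (by norm_num)).add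
      (integrableOn_rpow_mul_exp_neg_mul (by linarith) (by norm_num))).const_mul _
  · refine (ae_restrict_iff' measurableSet_Ioi).2 (Eventually.of_forall fun u (hu : 0 < u) => ?_)
    have h1 : Tendsto (fun z : ℝ => z / (z + 1)) atTop (nhds 1) := by
      have h0 : Tendsto (fun z : ℝ => 1 - (z + 1)⁻¹) atTop (nhds (1 - 0)) :=
        tendsto_const_nhds.sub
          (tendsto_inv_atTop_zero.comp (tendsto_atTop_add_const_right _ _ tendsto_id))
      rw [sub_zero] at h0
      refine h0.congr' ?_
      filter_upwards [eventually_gt_atTop 0] with z hz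
      field_simp
      ring
    have h2 : Tendsto (fun z : ℝ => exp (-(z * u / (z + 1)))) atTop (nhds (exp (-u))) := by
      refine (Real.continuous_exp.tendsto _).comp (Tendsto.neg ?_)
      simpa [div_mul_eq_mul_div] using h1.mul_const u
    have h3 : Tendsto (fun z => (Ici A).indicator S (z * u) / S z) atTop (nhds 1) := by
      refine (hS.2.2 u hu).congr' ?_
      filter_upwards [(tendsto_id.atTop_mul_const hu).eventually_ge_atTop A] with z hz
      rw [indicator_of_mem (by exact hz), mul_comm z u]
    simpa using (h2.mul_const (u ^ β)).mul h3

/-- The Abelian theorem for the Laplace transform of `t ^ β * S t`, `S` slowly varying. -/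
lemma SlowlyVarying.tendsto_laplace {S : ℝ → ℝ} (hS : SlowlyVarying S) {β : ℝ} (hβ : -1 < β)
    (hint : ∀ᶠ z in atTop,
      IntegrableOn (fun t => exp (-(t / (z + 1))) * t ^ β * S t) (Ioi 0)) :
    Tendsto (fun z => (∫ t in Ioi (0 : ℝ), exp (-(t / (z + 1))) * t ^ β * S t) /
      (z ^ (β + 1) * S z)) atTop (nhds (Gamma (β + 1))) := by
  obtain ⟨A, hA, hlim⟩ := hS.tendsto_integral_scaled hβ
  let f : ℝ → ℝ → ℝ := fun z t => exp (-(t / (z + 1))) * t ^ β * S t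
  have hf0 : ∀ z, ∀ t > 0, 0 ≤ f z t := fun z t ht =>
    mul_nonneg (by positivity) (hS.2.1 t ht)
  have hsub : Ioo 0 A ⊆ Ioi (0 : ℝ) := Ioo_subset_Ioi_self
  have hnum : Tendsto (fun z => (∫ t in Ioo 0 A, f z t) / (z ^ (β + 1) * S z)) atTop
      (nhds 0) := by
    obtain ⟨w, hw0, hw⟩ := ((eventually_gt_atTop 0).and hint).exists
    have hfw : IntegrableOn (fun t => exp (A / (w + 1)) * f w t) (Ioo 0 A) :=
      (hw.mono_set hsub).const_mul _
    have hden := hS.tendsto_rpow_mul_atTop (a := β + 1) (by linarith)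
    refine squeeze_zero' (g := fun z => (∫ t in Ioo 0 A, exp (A / (w + 1)) * f w t) /
      (z ^ (β + 1) * S z)) ?_ ?_ (hden.const_div_atTop _)
    · filter_upwards [hden.eventually_gt_atTop 0] with z hz
      exact div_nonneg (setIntegral_nonneg measurableSet_Ioo fun t ht => hf0 z t ht.1) hz.le
    · filter_upwards [hden.eventually_gt_atTop 0, hint, eventually_gt_atTop 0] with z hz hi hz0
      refine div_le_div_of_nonneg_right ?_ hz.le
      refine setIntegral_mono_on (hi.mono_set hsub) hfw measurableSet_Ioo fun t ht => ?_
      have := ht.1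
      have := ht.2
      have hSt := hS.2.1 t ht.1
      calc f z t ≤ exp (A / (w + 1) + -(t / (w + 1))) * t ^ β * S t := by
            simp only [f]
            gcongr
            have h1 : t / (w + 1) ≤ A / (w + 1) := by gcongr
            have h2 : 0 ≤ t / (z + 1) := by positivity
            linarith
        _ = _ := by rw [exp_add]; ring
  have hsum := hnum.add hlim
  rw [zero_add] at hsum
  refine hsum.congr' ?_
  filter_upwards [hint, eventually_gt_atTop 0, hS.eventually_pos] with z hi hz0 hSz
  let g : ℝ → ℝ := fun t => exp (-(t / (z + 1))) * t ^ β * (Ici A).indicator S t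
  have h1 : ∫ t in Ioi 0, f z t = (∫ t in Ioo 0 A, f z t) + ∫ t in Ici A, f z t := by
    rw [← Ioo_union_Ici_eq_Ioi hA]
    refine setIntegral_union ?_ measurableSet_Ici (hi.mono_set hsub)
      (hi.mono_set fun x hx => hA.trans_le hx)
    exact disjoint_left.2 fun x hx hx' => not_le.2 hx.2 hx'
  have h2 : ∫ t in Ici A, f z t = ∫ t in Ioi 0, g t := by
    have : g = (Ici A).indicator (f z) := by
      ext t
      by_cases ht : t ∈ Ici A <;> simp [g, f, ht]
    rw [this, setIntegral_indicator measurableSet_Ici]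
    congr 2
    exact (inter_eq_right.2 fun x hx => hA.trans_le hx).symm
  have h3 := integral_comp_mul_left_Ioi g 0 hz0
  rw [mul_zero, smul_eq_mul, eq_inv_mul_iff_mul_eq₀ hz0.ne'] at h3
  change _ = (∫ t in Ioi 0, f z t) / _
  rw [h1, h2, add_div, ← h3]
  congr 1
  rw [← integral_const_mul, ← integral_div]
  refine setIntegral_congr_fun measurableSet_Ioi fun u (hu : 0 < u) => ?_
  simp only [g]
  rw [mul_rpow hz0.le hu.le, rpow_add_one hz0.ne']
  have := rpow_pos_of_pos hz0 β
  field_simp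

lemma image_exp_neg_Ioi : (fun t : ℝ => exp (-t)) '' Ioi 0 = Ioo 0 1 := by
  ext x
  constructor
  · rintro ⟨t, ht, rfl⟩
    exact ⟨exp_pos _, Real.exp_lt_one_iff.2 (neg_lt_zero.2 ht)⟩
  · rintro ⟨h0, h1⟩
    exact ⟨-Real.log x, neg_pos.2 (log_neg h0 h1), by simp [exp_log h0]⟩

lemma hasDerivWithinAt_exp_neg (s : Set ℝ) (x : ℝ) :
    HasDerivWithinAt (fun t : ℝ => exp (-t)) (-exp (-x)) s x := by
  simpa using (hasDerivAt_neg x).exp.hasDerivWithinAt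

lemma injOn_exp_neg (s : Set ℝ) : InjOn (fun t : ℝ => exp (-t)) s := fun x _ y _ h => by
  simpa using h

lemma exp_neg_change_of_variables {p : ℝ} (hp : 1 < p) (β : ℝ) (S : ℝ → ℝ) {t : ℝ}
    (ht : 0 < t) :
    |-exp (-t)| • (exp (-t) ^ (-(1 / p)) * |Real.log (exp (-t))| ^ β * S |Real.log (exp (-t))|) =
      exp (-(t / (1 / (p - 1) + 1))) * t ^ β * S t := by
  have h0 : p - 1 ≠ 0 := by linarith
  have e : -(t / (1 / (p - 1) + 1)) = -t + -t * -(1 / p) := by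
    have : 1 / (p - 1) + 1 = p / (p - 1) := by field_simp; ring
    rw [this]
    field_simp
    ring
  rw [e, exp_add, abs_neg, abs_of_pos (exp_pos _), Real.log_exp, abs_neg, abs_of_pos ht,
    ← exp_mul, smul_eq_mul]
  ring

/-- as `p → 1+`,
`∫_0^1 z^{-1/p} |log z|^β S(|log z|) dz ∼ Γ(β+1) (p-1)^{-β-1} S(1/(p-1))`. -/
theorem integral_log_slowly_varying_asymptotics
    (β : ℝ) (hβ : 0 ≤ β) (S : ℝ → ℝ) (hS : SlowlyVarying S)
    (hfin : ∃ p0 : ℝ, 1 < p0 ∧ ∀ p ∈ Set.Ioo (1:ℝ) p0,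
      IntegrableOn (fun z => z ^ (-(1/p)) * |Real.log z| ^ β * S |Real.log z|)
        (Set.Ioo 0 1)) :
    Tendsto (fun p =>
        (∫ z in Set.Ioo (0:ℝ) 1, z ^ (-(1/p)) * |Real.log z| ^ β * S |Real.log z|) /
          (Real.Gamma (β + 1) * (p - 1) ^ (-β - 1) * S (1 / (p - 1))))
      (nhdsWithin 1 (Set.Ioi 1)) (nhds 1) := by
  obtain ⟨p0, hp0, hfin⟩ := hfin
  have hΓ : 0 < Gamma (β + 1) := Gamma_pos_of_pos (by linarith)
  have hint : ∀ᶠ z in atTop,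
      IntegrableOn (fun t => exp (-(t / (z + 1))) * t ^ β * S t) (Ioi 0) := by
    filter_upwards [eventually_gt_atTop (1 / (p0 - 1)), eventually_gt_atTop 0] with z hz hz0
    have hz' : 1 / z < p0 - 1 := (one_div_lt hz0 (by linarith)).2 hz
    have hp : 1 < 1 + 1 / z := by linarith [one_div_pos.2 hz0]
    have h1 := hfin (1 + 1 / z) ⟨hp, by linarith⟩
    rw [← image_exp_neg_Ioi, integrableOn_image_iff_integrableOn_abs_deriv_smul measurableSet_Ioi
      (fun x _ => hasDerivWithinAt_exp_neg _ x) (injOn_exp_neg _)] at h1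
    refine (integrableOn_congr_fun (fun t ht => ?_) measurableSet_Ioi).1 h1
    simpa using exp_neg_change_of_variables hp β S ht
  have hz : Tendsto (fun p : ℝ => 1 / (p - 1)) (nhdsWithin 1 (Ioi 1)) atTop := by
    simp only [one_div]
    refine tendsto_inv_nhdsGT_zero.comp (tendsto_nhdsWithin_iff.2 ⟨?_, ?_⟩)
    · have : Tendsto (fun p : ℝ => p - 1) (nhds 1) (nhds (1 - 1)) :=
        (_root_.continuous_sub_right 1).tendsto 1
      rw [sub_self] at this
      exact this.mono_left nhdsWithin_le_nhds
    · filter_upwards [self_mem_nhdsWithin] with p (hp : 1 < p)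
      exact sub_pos.2 hp
  have hlim := ((hS.tendsto_laplace (by linarith : -1 < β) hint).comp hz).div_const
    (Gamma (β + 1))
  rw [div_self hΓ.ne'] at hlim
  refine hlim.congr' ?_
  filter_upwards [self_mem_nhdsWithin] with p (hp : 1 < p)
  have hp1 : 0 < p - 1 := sub_pos.2 hp
  rw [← image_exp_neg_Ioi, integral_image_eq_integral_abs_deriv_smul measurableSet_Ioi
    (fun x _ => hasDerivWithinAt_exp_neg _ x) (injOn_exp_neg _),
    setIntegral_congr_fun measurableSet_Ioi
      (fun t ht => exp_neg_change_of_variables hp β S ht)]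
  have e : (p - 1) ^ (-β - 1) = (1 / (p - 1)) ^ (β + 1) := by
    rw [one_div, inv_rpow hp1.le, ← rpow_neg hp1.le]
    ring_nf
  rw [e, Function.comp, div_div]
  congr 1
  ring
end
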